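/- arXiv:2009.08888 — 2 statements merged into one kernel-verified Lean document; each statement's English description precedes it below -/
import Mathlib

section
/- Let Λ be a cyclic Nakayama algebra with φdim Λ = 2. Then findim Λ = 2 if and only if del Λ = 2. -/
open Function DirectSum
open scoped Classical

noncomputable section

section Preamble

variable (A : Type) [Ring A]

/-- A submodule is small (superfluous) if it has no proper supplement. -/
def IsSmallSubmodule {M : Type} [AddCommGroup M] [Module A M] (N : Submodule A M) : Prop :=
  ∀ K : Submodule A M, N ⊔ K = ⊤ → K = ⊤

/-- `P` is a projective cover of `M`: `P` is projective, finitely generated, and there is a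
surjection `P → M` with small (superfluous) kernel. -/
def IsProjCoverOf (P M : ModuleCat.{0} A) : Prop :=
  Module.Projective A ↥P ∧ Module.Finite A ↥P ∧
    ∃ f : ↥P →ₗ[A] ↥M, Function.Surjective f ∧ IsSmallSubmodule A (LinearMap.ker f)

/-- `N` is (isomorphic to) the syzygy `Ω(M)`, i.e. the kernel of a projective cover of `M`. -/
def IsSyzygyOf (N M : ModuleCat.{0} A) : Prop :=
  ∃ (P : ModuleCat.{0} A) (f : ↥P →ₗ[A] ↥M),
    Module.Projective A ↥P ∧ Module.Finite A ↥P ∧ Function.Surjective f ∧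
      IsSmallSubmodule A (LinearMap.ker f) ∧ Nonempty (↥N ≃ₗ[A] ↥(LinearMap.ker f))

/-- `N` is (isomorphic to) the `n`-th syzygy `Ω^n(M)`. -/
def IsNthSyzygyOf : ℕ → ModuleCat.{0} A → ModuleCat.{0} A → Prop
  | 0 => fun N M => Nonempty (↥N ≃ₗ[A] ↥M)
  | n + 1 => fun N M => ∃ K : ModuleCat.{0} A, IsNthSyzygyOf n K M ∧ IsSyzygyOf A N K

/-- An indecomposable module: nontrivial, with no nontrivial direct sum decomposition. -/
def IndecomposableModule (M : ModuleCat.{0} A) : Prop :=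
  Nontrivial ↥M ∧ ∀ N N' : Submodule A ↥M, IsCompl N N' → N = ⊥ ∨ N = ⊤

/-- A uniserial module: the submodules form a chain. -/
def IsUniserialModule (M : ModuleCat.{0} A) : Prop :=
  ∀ N N' : Submodule A ↥M, N ≤ N' ∨ N' ≤ N

/-- A (one-sided) Nakayama condition: an Artinian ring all of whose finitely generated
indecomposable modules are uniserial. -/
def IsNakayamaRing : Prop :=
  IsArtinianRing A ∧
    ∀ M : ModuleCat.{0} A, Module.Finite A ↥M → IndecomposableModule A M → IsUniserialModule A M

/-- A Nakayama algebra: all indecomposable finitely generated (left and right) modules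
are uniserial. -/
def IsNakayamaAlgebra : Prop := IsNakayamaRing A ∧ IsNakayamaRing Aᵐᵒᵖ

/-- Connectedness: the only central idempotents are `0` and `1`. -/
def IsConnectedRing : Prop :=
  ∀ e : A, IsIdempotentElem e → e ∈ Set.center A → e = 0 ∨ e = 1

/-- A cyclic Nakayama algebra: a connected Nakayama algebra whose quiver is a cyclically
oriented cycle, equivalently with no simple projective module. -/
def IsCyclicNakayama : Prop :=
  IsNakayamaAlgebra A ∧ IsConnectedRing A ∧
    ∀ M : ModuleCat.{0} A, IsSimpleModule A ↥M → ¬ Module.Projective A ↥M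

/-- The projective dimension of a module, computed via minimal projective resolutions:
the least `n` such that `Ω^n(M)` is projective (`⊤ = ∞` if there is none). -/
def projDim (M : ModuleCat.{0} A) : ℕ∞ :=
  sInf ((fun n : ℕ => (n : ℕ∞)) ''
    {n : ℕ | ∃ N : ModuleCat.{0} A, IsNthSyzygyOf A n N M ∧ Module.Projective A ↥N})

/-- The finitistic dimension: the supremum of the (finite) projective dimensions of
finitely generated modules of finite projective dimension. -/
def finDim : ℕ∞ :=
  sSup {d : ℕ∞ | d ≠ ⊤ ∧ ∃ M : ModuleCat.{0} A, Module.Finite A ↥M ∧ projDim A M = d}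

/-- The global dimension: the supremum of the projective dimensions of all finitely
generated modules. -/
def globalDim : ℕ∞ :=
  sSup {d : ℕ∞ | ∃ M : ModuleCat.{0} A, Module.Finite A ↥M ∧ projDim A M = d}

/-- `N` is a direct summand of `M`. -/
def IsDirectSummandOf (N M : ModuleCat.{0} A) : Prop :=
  ∃ C : ModuleCat.{0} A, Nonempty (↥M ≃ₗ[A] (↥N × ↥C))

/-- The delooping level of a module `M`:
`del M = min { d | Ω^d(M) is a direct summand of A ⊕ Ω^{d+1}(M') for some f.g. M' }`. -/
def delMod (M : ModuleCat.{0} A) : ℕ∞ :=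
  sInf ((fun n : ℕ => (n : ℕ∞)) ''
    {d : ℕ | ∃ (M' N N' : ModuleCat.{0} A), Module.Finite A ↥M' ∧
      IsNthSyzygyOf A d N M ∧ IsNthSyzygyOf A (d + 1) N' M' ∧
      IsDirectSummandOf A N (ModuleCat.of A (A × ↥N'))})

/-- The delooping level of the algebra: the supremum over simple modules. -/
def delAlg : ℕ∞ :=
  sSup {d : ℕ∞ | ∃ S : ModuleCat.{0} A, IsSimpleModule A ↥S ∧ delMod A S = d}

/-- A periodic module: `Ω^t(M) ≅ M` for some `t ≥ 1`. -/
def IsPeriodicModule (M : ModuleCat.{0} A) : Prop :=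
  ∃ t : ℕ, 1 ≤ t ∧ IsNthSyzygyOf A t M M

/-- Selfinjectivity: the regular module is injective. -/
def IsSelfinjectiveRing : Prop := Module.Injective A A

/-- The socle of a module: the sum of all simple submodules. -/
def socleOf (M : ModuleCat.{0} A) : Submodule A ↥M :=
  sSup {N : Submodule A ↥M | IsSimpleModule A ↥N}

/-- The radical of a module: `rad M = J(A)·M`. -/
def radOf (M : Type) [AddCommGroup M] [Module A M] : Submodule A M :=
  (Ideal.jacobson (⊥ : Ideal A)) • (⊤ : Submodule A M)

/-- The top of a module: `M / rad M`. -/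
abbrev topOf (M : Type) [AddCommGroup M] [Module A M] :=
  M ⧸ radOf A M

end Preamble

section Phi

variable (A : Type) [Ring A]

/-- Finitely generated indecomposable modules. -/
def FGIndec := {M : ModuleCat.{0} A // Module.Finite A ↥M ∧ IndecomposableModule A M}

/-- Isomorphism as a setoid on finitely generated indecomposable modules. -/
def indecSetoid : Setoid (FGIndec A) where
  r X Y := Nonempty (↥X.1 ≃ₗ[A] ↥Y.1)
  iseqv := ⟨fun _ => ⟨LinearEquiv.refl A _⟩,
            fun h => h.elim fun e => ⟨e.symm⟩,
            fun h h' => h.elim fun e => h'.elim fun e' => ⟨e.trans e'⟩⟩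

/-- Isomorphism classes of finitely generated indecomposable modules. -/
abbrev IndecIso := Quotient (indecSetoid A)

/-- The free abelian group on iso-classes of f.g. indecomposable modules. -/
abbrev K0Group := IndecIso A →₀ ℤ

/-- `f` records a decomposition of `M` as a direct sum of indecomposables with
multiplicities. -/
def IsDecompositionOf (f : IndecIso A →₀ ℕ) (M : ModuleCat.{0} A) : Prop :=
  Nonempty (↥M ≃ₗ[A] DirectSum (Σ x : f.support, Fin (f x.1))
    (fun i => ↥((Quotient.out i.1.1).1)))

/-- The class of `M` in the free abelian group on indecomposables (junk value `0` if no
decomposition exists). -/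
def decompClass (M : ModuleCat.{0} A) : K0Group A :=
  if h : ∃ f : IndecIso A →₀ ℕ, IsDecompositionOf A f M
  then (Classical.choose h).mapRange (fun m : ℕ => (m : ℤ)) (by simp)
  else 0

/-- A choice of syzygy module `Ω(M)` (junk value `0` if no projective cover exists). -/
def syzygyModule (M : ModuleCat.{0} A) : ModuleCat.{0} A :=
  if h : ∃ N : ModuleCat.{0} A, IsSyzygyOf A N M then Classical.choose h
  else ModuleCat.of A PUnit

/-- The Igusa–Todorov endomorphism `L` of the free abelian group on indecomposables,
sending `[M] ↦ [Ω M]`. -/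
def syzygyEnd : AddMonoid.End (K0Group A) :=
  Finsupp.liftAddHom fun x : IndecIso A =>
    (zmultiplesHom (K0Group A)) (decompClass A (syzygyModule A (Quotient.out x).1))

/-- The generators `[X]`, `X` an indecomposable direct summand of `M`, of the subgroup
`⟨add M⟩`. -/
def addGenerators (M : ModuleCat.{0} A) : Set (K0Group A) :=
  {g | ∃ (X : ModuleCat.{0} A) (h : Module.Finite A ↥X ∧ IndecomposableModule A X),
      IsDirectSummandOf A X M ∧ g = Finsupp.single (Quotient.mk (indecSetoid A) ⟨X, h⟩) 1}

/-- The Igusa–Todorov function `φ(M)`: the least `t` at which the rank of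
`L^t⟨add M⟩` stabilizes. -/
def phiMod (M : ModuleCat.{0} A) : ℕ∞ :=
  sInf ((fun n : ℕ => (n : ℕ∞)) ''
    {t : ℕ | ∀ j : ℕ, 1 ≤ j →
      Module.finrank ℤ
        ↥(AddSubgroup.map ((syzygyEnd A) ^ t) (AddSubgroup.closure (addGenerators A M))) =
      Module.finrank ℤ
        ↥(AddSubgroup.map ((syzygyEnd A) ^ (t + j)) (AddSubgroup.closure (addGenerators A M)))})

/-- The `φ`-dimension of the algebra. -/
def phiDim : ℕ∞ :=
  sSup {d : ℕ∞ | ∃ M : ModuleCat.{0} A, Module.Finite A ↥M ∧ phiMod A M = d}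

end Phi

section Epsilon

variable (A : Type) [Ring A]

/-- `T` is (isomorphic to) the socle of some indecomposable projective module. -/
def IsSocleOfIndecProjective (T : ModuleCat.{0} A) : Prop :=
  IsSimpleModule A ↥T ∧ ∃ Q : ModuleCat.{0} A, Module.Projective A ↥Q ∧ Module.Finite A ↥Q ∧
    IndecomposableModule A Q ∧ Nonempty (↥T ≃ₗ[A] ↥(socleOf A Q))

/-- `S` belongs to `S'(Λ)`: `S ≅ S_{i+1}` where `S_i` is a socle of an indecomposable
projective; here `S_{i+1} = top (rad P(S_i))` for the cyclic quiver. -/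
def IsInSPrime (S : ModuleCat.{0} A) : Prop :=
  IsSimpleModule A ↥S ∧ ∃ T P : ModuleCat.{0} A, IsSocleOfIndecProjective A T ∧
    IsProjCoverOf A P T ∧ Nonempty ((topOf A ↥(radOf A ↥P)) ≃ₗ[A] ↥S)

/-- `B` is (isomorphic to) the syzygy filtered algebra
`ε(Λ) = End_Λ(⊕_{S ∈ S'(Λ)} P(S))`. -/
def IsSyzygyFilteredAlgebra (B : Type) [Ring B] : Prop :=
  ∃ (ι : Type) (_ : Fintype ι) (Sf Pf : ι → ModuleCat.{0} A),
    (∀ i, IsInSPrime A (Sf i) ∧ IsProjCoverOf A (Pf i) (Sf i)) ∧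
    (∀ i j, Nonempty (↥(Sf i) ≃ₗ[A] ↥(Sf j)) → i = j) ∧
    (∀ S : ModuleCat.{0} A, IsInSPrime A S → ∃ i, Nonempty (↥S ≃ₗ[A] ↥(Sf i))) ∧
    Nonempty (B ≃+* Module.End A (DirectSum ι fun i => ↥(Pf i)))

/-- `B` is (isomorphic to) the `d`-th iterated syzygy filtered algebra `ε^d(Λ)`,
each intermediate step being a cyclic non-selfinjective Nakayama algebra. -/
def IsIterSyzygyFiltered (d : ℕ) (B : Type) [Ring B] : Prop :=
  ∃ C : ℕ → RingCat.{0},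
    Nonempty (A ≃+* ↥(C 0)) ∧ Nonempty (↥(C d) ≃+* B) ∧
    ∀ i < d, IsCyclicNakayama ↥(C i) ∧ ¬ IsSelfinjectiveRing ↥(C i) ∧
      IsSyzygyFilteredAlgebra ↥(C i) ↥(C (i + 1))

end Epsilon


section KupischMap

/-- A monotone self-map of `ℤ` commuting with translation by `N > 0` and moving every point up by
at least two; it sends `i` to the end of the interval carried by the `i`-th indecomposable
projective of a cyclic Nakayama algebra. -/
structure IsKupischMap (p : ℤ → ℤ) (N : ℤ) : Prop where
  mono : Monotone p
  add_two_le : ∀ i, i + 2 ≤ p i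
  pos : 0 < N
  add_period : ∀ i, p (i + N) = p i + N

variable {p : ℤ → ℤ} {N : ℤ}

theorem apply_add_mul_of_apply_add {f : ℤ → ℤ} (h : ∀ i, f (i + N) = f i + N) (i k : ℤ) :
    f (i + k * N) = f i + k * N := by
  induction k using Int.induction_on with
  | zero => simp
  | succ k ih =>
    have := h (i + k * N)
    rw [show i + (k + 1) * N = i + k * N + N by ring, this, ih]; ring
  | pred k ih =>
    have := h (i + (-k - 1) * N)
    rw [show i + (-k - 1) * N + N = i + -k * N by ring, ih] at this
    linarith

/-- A self-map of a periodic subset of `ℤ` that commutes with the period is injective if and only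
if it is surjective. -/
theorem injOn_iff_surjOn_of_periodic {S : Set ℤ} {f : ℤ → ℤ} (hN : 0 < N)
    (hS : ∀ i ∈ S, ∀ k : ℤ, i + k * N ∈ S) (hf : ∀ i ∈ S, ∀ k : ℤ, f (i + k * N) = f i + k * N)
    (hfS : Set.MapsTo f S S) : Set.InjOn f S ↔ Set.SurjOn f S S := by
  let T := {i : ℤ // i ∈ S ∧ 0 ≤ i ∧ i < N}
  have hfin : Finite T := by
    refine Set.Finite.subset (Set.finite_Ico (0 : ℤ) N) (s := Set.Ico 0 N) ?_ |>.to_subtype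
    intro i hi
    exact ⟨hi.2.1, hi.2.2⟩
  have hmod : ∀ i, i % N = i + (-(i / N)) * N := fun i => by
    have := Int.emod_add_mul_ediv i N; linarith
  have hred : ∀ i ∈ S, i % N ∈ S ∧ 0 ≤ i % N ∧ i % N < N := fun i hi =>
    ⟨hmod i ▸ hS i hi _, Int.emod_nonneg _ hN.ne', Int.emod_lt_of_pos _ hN⟩
  let g : T → T := fun t => ⟨f t.1 % N, hred _ (hfS t.2.1)⟩
  have key : Injective g ↔ Surjective g := Finite.injective_iff_surjective
  constructor
  · intro h
    have hg : Injective g := by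
      rintro ⟨a, ha, ha0, haN⟩ ⟨b, hb, hb0, hbN⟩ hab
      have h1 : f a % N = f b % N := congrArg Subtype.val hab
      obtain ⟨k, hk⟩ := Int.ModEq.dvd (show f a ≡ f b [ZMOD N] from h1)
      have h2 : f b = f (a + k * N) := by rw [hf a ha]; linarith
      have h3 : b = a + k * N := h hb (hS a ha k) h2
      have : k = 0 := by
        rcases lt_trichotomy k 0 with h | h | h
        · nlinarith
        · exact h
        · nlinarith
      simp [h3, this]
    intro y hy
    obtain ⟨⟨t, ht, _⟩, hgt⟩ := key.1 hg ⟨y % N, hred y hy⟩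
    have h1 : f t % N = y % N := congrArg Subtype.val hgt
    obtain ⟨k, hk⟩ := Int.ModEq.dvd (show f t ≡ y [ZMOD N] from h1)
    exact ⟨t + k * N, hS t ht k, by rw [hf t ht]; linarith⟩
  · intro h
    have hg : Surjective g := by
      rintro ⟨y, hy, hy0, hyN⟩
      obtain ⟨x, hx, rfl⟩ := h hy
      refine ⟨⟨x % N, hred x hx⟩, Subtype.ext ?_⟩
      change f (x % N) % N = f x
      rw [hmod x, hf x hx, Int.add_mul_emod_self_right, Int.emod_eq_of_lt hy0 hyN]
    intro a ha b hb hab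
    have h1 : (⟨a % N, hred a ha⟩ : T) = ⟨b % N, hred b hb⟩ := by
      apply key.2 hg
      apply Subtype.ext
      change f (a % N) % N = f (b % N) % N
      rw [hmod a, hmod b, hf a ha, hf b hb, hab, Int.add_mul_emod_self_right,
        Int.add_mul_emod_self_right]
    obtain ⟨k, hk⟩ := Int.ModEq.dvd (show a ≡ b [ZMOD N] from congrArg Subtype.val h1)
    have hb' : b = a + k * N := by linarith
    have h2 := hf a ha k
    rw [← hb', hab] at h2
    linarith

namespace IsKupischMap

theorem lt_apply (hp : IsKupischMap p N) (i : ℤ) : i < p i := by linarith [hp.add_two_le i]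

/-- Every fibre of a Kupisch map has a least element. -/
theorem exists_fibre_min (hp : IsKupischMap p N) (y : ℤ) :
    ∃ j ≤ y, p j = p y ∧ p (j - 1) < p j := by
  obtain ⟨j, hj, hmin⟩ := Int.exists_least_of_bdd (P := fun j => p j = p y)
    ⟨y - N, fun z hz => by
      by_contra! h
      have h1 := hp.mono h.le
      have h2 := hp.add_period (y - N)
      have := hp.pos
      rw [sub_add_cancel] at h2
      linarith⟩ ⟨y, rfl⟩
  refine ⟨j, hmin y rfl, hj, lt_of_le_of_ne (hp.mono (by linarith)) fun h => ?_⟩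
  have := hmin (j - 1) (h.trans hj)
  linarith

theorem exists_fibre_max (hp : IsKupischMap p N) (y : ℤ) :
    ∃ i, y ≤ i ∧ p i = p y ∧ p i < p (i + 1) := by
  obtain ⟨j, hj, hmax⟩ := Int.exists_greatest_of_bdd (P := fun j => p j = p y)
    ⟨y + N, fun z hz => by
      by_contra! h
      have h1 := hp.mono h.le
      have h2 := hp.add_period y
      have := hp.pos
      linarith⟩ ⟨y, rfl⟩
  refine ⟨j, hmax y rfl, hj, lt_of_le_of_ne (hp.mono (by linarith)) fun h => ?_⟩
  have := hmax (j + 1) (h.symm.trans hj)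
  linarith

theorem injOn_range_iff (hp : IsKupischMap p N) :
    Set.InjOn p (Set.range p) ↔ Set.SurjOn p (Set.range p) (Set.range p) := by
  refine injOn_iff_surjOn_of_periodic hp.pos ?_
    (fun i _ k => apply_add_mul_of_apply_add hp.add_period i k) fun i _ => ⟨i, rfl⟩
  rintro _ ⟨i, rfl⟩ k
  exact ⟨i + k * N, apply_add_mul_of_apply_add hp.add_period i k⟩

theorem injOn_jumps (hp : IsKupischMap p N) : Set.InjOn p {j | p (j - 1) < p j} := by
  intro a ha b hb hab
  by_contra hne
  rcases lt_or_gt_of_ne hne with h | h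
  · have := hp.mono (show a ≤ b - 1 by omega)
    have : p (b - 1) < p b := hb
    omega
  · have := hp.mono (show b ≤ a - 1 by omega)
    have : p (a - 1) < p a := ha
    omega

/-- If all jumps of `p` lie in the range of `p`, then `p` is injective on its range. -/
theorem injOn_range_of_jumps (hp : IsKupischMap p N)
    (h : ∀ i, p i < p (i + 1) → i + 1 ∈ Set.range p) :
    Set.InjOn p (Set.range p) := by
  set J : Set ℤ := {j | p (j - 1) < p j} with hJ
  have hJr : ∀ j ∈ J, ∃ i ∈ J, p i = j := by
    intro j hj
    obtain ⟨u, hu⟩ := h (j - 1) (by simpa [hJ] using hj)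
    obtain ⟨i, -, hi, hi'⟩ := hp.exists_fibre_min u
    exact ⟨i, hi', by rw [hi, hu]; ring⟩
  choose! g hgJ hg using hJr
  have hper := apply_add_mul_of_apply_add hp.add_period
  have hJper : ∀ i ∈ J, ∀ k : ℤ, i + k * N ∈ J := by
    intro i hi k
    change p (i + k * N - 1) < p (i + k * N)
    rw [show i + k * N - 1 = i - 1 + k * N by ring, hper, hper]
    have : p (i - 1) < p i := hi
    linarith
  have hsurj : Set.SurjOn g J J := by
    refine (injOn_iff_surjOn_of_periodic hp.pos hJper ?_ hgJ).1 ?_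
    · intro i hi k
      refine hp.injOn_jumps (hgJ _ (hJper i hi k)) (hJper _ (hgJ i hi) k) ?_
      rw [hg _ (hJper i hi k), hper, hg i hi]
    · intro a ha b hb hab
      rw [← hg a ha, ← hg b hb, hab]
  have hsub : Set.range p ⊆ J := by
    rintro _ ⟨u, rfl⟩
    obtain ⟨i, -, hi, hi'⟩ := hp.exists_fibre_min u
    obtain ⟨j, hj, rfl⟩ := hsurj hi'
    rw [← hi, hg j hj]
    exact hj
  exact hp.injOn_jumps.mono hsub

theorem injOn_range_of_consecutive (hp : IsKupischMap p N)
    (h : ∀ i, p i < p (i + 1) → p (p i) ≠ p (p (i + 1))) :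
    Set.InjOn p (Set.range p) := by
  have key : ∀ a b, p a < p b → p (p a) ≠ p (p b) := by
    intro a b hab heq
    obtain ⟨i, hai, hia, hi⟩ := hp.exists_fibre_max a
    have hib : i + 1 ≤ b := by
      by_contra! hlt
      have := hp.mono (show b ≤ i by omega)
      omega
    have h1 := hp.mono (hp.mono hib)
    have h2 := hp.mono (hp.mono (show i ≤ i + 1 by omega))
    rw [← hia] at heq
    exact h i hi (by omega)
  rintro _ ⟨a, rfl⟩ _ ⟨b, rfl⟩ hab
  by_contra hne
  rcases lt_or_gt_of_ne hne with hlt | hlt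
  · exact key a b hlt hab
  · exact key b a hlt hab.symm

theorem no_projDim_two_iff (hp : IsKupischMap p N) :
    (∀ i j, i < j → j < p i → p i < p j → p j ≠ p (p i)) ↔
      ∀ i, p i < p (i + 1) → i + 1 ∈ Set.range p := by
  constructor
  · intro h
    have hinj : Set.InjOn p (Set.range p) := by
      refine hp.injOn_range_of_consecutive fun i hi heq => ?_
      obtain ⟨j, hj, hjp, hj'⟩ := hp.exists_fibre_min (p i)
      have h3 := hp.lt_apply (p i)
      have h4 := hp.lt_apply (p (i + 1))
      have h5 := hp.add_two_le i
      rcases hj.lt_or_eq with hlt | hjeq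
      · refine h i j ?_ hlt (by omega) hjp
        by_contra! hle
        have := hp.mono hle
        omega
      · refine h (i + 1) j (by omega) (by omega) (by omega) (by omega)
    intro j hj
    obtain ⟨z, ⟨i, rfl⟩, hz⟩ := (hp.injOn_range_iff.1 hinj) ⟨j + 1, rfl⟩
    have h1 : j + 1 ≤ p i := by
      by_contra! hlt
      have := hp.mono (show p i ≤ j by omega)
      omega
    rcases h1.lt_or_eq with hlt | heq
    · have h2 := hp.lt_apply (p i)
      refine absurd hz.symm (h i (j + 1) ?_ hlt (by omega))
      by_contra! hle
      have := hp.mono hle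
      omega
    · exact ⟨i, heq.symm⟩
  · intro h i j hij hj hpij heq
    have hinj := hp.injOn_range_of_jumps h
    obtain ⟨k, hk, hkp, hk'⟩ := hp.exists_fibre_min j
    obtain ⟨u, hu⟩ := h (k - 1) (by simpa using hk')
    have : p u = p i := hinj ⟨u, rfl⟩ ⟨i, rfl⟩ (by rw [hu, sub_add_cancel, hkp, heq])
    omega

theorem no_projDim_three_iff (hp : IsKupischMap p N) :
    (∀ i j, i < j → j < p i → p i < p j → p j < p (p i) → p (p i) ≠ p (p j)) ↔
      ∀ i, p i < p (i + 1) → p (i + 1) ∈ Set.range (p ∘ p) := by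
  constructor
  · intro h
    have hinj : Set.InjOn p (Set.range p) := by
      refine hp.injOn_range_of_consecutive fun i hi heq => ?_
      have h4 := hp.lt_apply (p (i + 1))
      have h5 := hp.add_two_le i
      exact h i (i + 1) (by omega) (by omega) hi (by omega) (by omega)
    intro j hj
    obtain ⟨z, ⟨i, rfl⟩, hz⟩ := (hp.injOn_range_iff.1 hinj) ⟨j + 1, rfl⟩
    exact ⟨i, hz⟩
  · intro h i j hij hj hpij hlt heq
    have hinj : Set.InjOn p (Set.range p) := by
      rw [hp.injOn_range_iff]
      rintro _ ⟨y, rfl⟩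
      obtain ⟨k, hk, hkp, hk'⟩ := hp.exists_fibre_min y
      obtain ⟨u, hu⟩ := h (k - 1) (by simpa using hk')
      exact ⟨p u, ⟨u, rfl⟩, by rw [← hkp, ← sub_add_cancel k 1, ← hu]; rfl⟩
    have := hinj ⟨i, rfl⟩ ⟨j, rfl⟩ heq
    omega

end IsKupischMap

end KupischMap

section KupischData

/-- Kupisch data of a cyclic Nakayama algebra: a permutation of the vertices and the lengths of
the indecomposable projectives. -/
structure KupischData (V : Type) where
  succ : Equiv.Perm V
  len : V → ℕ
  two_le : ∀ v, 2 ≤ len v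
  le_succ : ∀ v, len v ≤ len (succ v) + 1

namespace KupischData

variable {V : Type} (D : KupischData V)

/-- The syzygy operator on labels `(top, length)` of uniserial modules; length zero labels the zero
module. -/
def omega (L : V × ℕ) : V × ℕ :=
  if L.2 = 0 then L else ((D.succ ^ L.2) L.1, D.len L.1 - L.2)

/-- The labels of modules that exist. -/
def Valid (L : V × ℕ) : Prop := L.2 ≤ D.len L.1

/-- The labels of projective modules. -/
def Proj (L : V × ℕ) : Prop := L.2 = 0 ∨ L.2 = D.len L.1

theorem len_le_len_pow (v : V) (m : ℕ) : D.len v ≤ D.len ((D.succ ^ m) v) + m := by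
  induction m with
  | zero => simp
  | succ m ih =>
    have := D.le_succ ((D.succ ^ m) v)
    rw [pow_succ', Equiv.Perm.mul_apply]
    omega

variable {D}

theorem Valid.omega {L : V × ℕ} (h : D.Valid L) : D.Valid (D.omega L) := by
  unfold KupischData.omega
  split_ifs
  · exact h
  · have := D.len_le_len_pow L.1 L.2
    simp only [Valid]
    omega

theorem Valid.iterate_omega {L : V × ℕ} (h : D.Valid L) (n : ℕ) : D.Valid (D.omega^[n] L) := by
  induction n with
  | zero => exact h
  | succ n ih => rw [iterate_succ_apply']; exact ih.omega

theorem Proj.omega {L : V × ℕ} (h : D.Proj L) : D.Proj (D.omega L) := by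
  unfold KupischData.omega
  split_ifs with h0
  · exact h
  · exact Or.inl (by have := h.resolve_left h0; simp [this])

theorem Proj.iterate_omega_of_le {L : V × ℕ} {m n : ℕ} (h : D.Proj (D.omega^[m] L)) (hmn : m ≤ n) :
    D.Proj (D.omega^[n] L) := by
  induction n, hmn using Nat.le_induction with
  | base => exact h
  | succ n _ ih => rw [iterate_succ_apply']; exact ih.omega

variable (D)

/-- Every label of finite projective dimension has projective dimension at most `d`. -/
def FinBound (d : ℕ) : Prop :=
  ∀ L, D.Valid L → (∃ n, D.Proj (D.omega^[n] L)) → D.Proj (D.omega^[d] L)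

/-- Every simple label has delooping level at most `d`. -/
def DelBound (d : ℕ) : Prop :=
  ∀ v, ∃ n ≤ d, D.Proj (D.omega^[n] (v, 1)) ∨
    ∃ L, D.Valid L ∧ D.omega^[n + 1] L = D.omega^[n] (v, 1)

theorem finBound_iff (d : ℕ) :
    D.FinBound d ↔ ∀ L, D.Valid L → D.Proj (D.omega^[d + 1] L) → D.Proj (D.omega^[d] L) := by
  refine ⟨fun h L hL hp => h L hL ⟨_, hp⟩, fun h L hL ⟨n, hn⟩ => ?_⟩
  have key : ∀ k, D.Proj (D.omega^[d + k] L) → D.Proj (D.omega^[d] L) := by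
    intro k
    induction k with
    | zero => exact id
    | succ k ih =>
      intro hk
      refine ih ?_
      rw [iterate_add_apply]
      refine h _ (hL.iterate_omega k) ?_
      rwa [← iterate_add_apply, add_right_comm]
  exact key n (hn.iterate_omega_of_le (by omega))

/-- The Kupisch map on the line of vertices through `v`. -/
def kmap (v : V) (i : ℤ) : ℤ := i + D.len ((D.succ ^ i) v)

/-- The label of the interval `[i, j)` on the line of vertices through `v`. -/
def lab (v : V) (i j : ℤ) : V × ℕ := ((D.succ ^ i) v, (j - i).toNat)

theorem isKupischMap [Finite V] (v : V) : IsKupischMap (D.kmap v) (orderOf D.succ) where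
  mono := by
    refine monotone_int_of_le_succ fun i => ?_
    have := D.le_succ ((D.succ ^ i) v)
    rw [← Equiv.Perm.mul_apply, ← zpow_one_add, add_comm 1 i] at this
    unfold kmap
    omega
  add_two_le i := by
    have := D.two_le ((D.succ ^ i) v)
    unfold kmap
    omega
  pos := by exact_mod_cast orderOf_pos D.succ
  add_period i := by
    unfold kmap
    rw [zpow_add, zpow_natCast, pow_orderOf_eq_one, mul_one]
    ring

theorem lab_zero (v : V) (m : ℕ) : D.lab v 0 m = (v, m) := by simp [lab]

variable {D}

theorem omega_lab {v : V} {i j : ℤ} (h : i < j) :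
    D.omega (D.lab v i j) = D.lab v j (D.kmap v i) := by
  have h0 : (j - i).toNat ≠ 0 := by omega
  have h1 : ((j - i).toNat : ℤ) = j - i := by omega
  unfold omega lab kmap
  rw [if_neg h0]
  ext
  · dsimp only
    rw [← zpow_natCast, h1, ← Equiv.Perm.mul_apply, ← zpow_add, sub_add_cancel]
  · dsimp only
    omega

theorem proj_lab {v : V} {i j : ℤ} (h : i ≤ j) :
    D.Proj (D.lab v i j) ↔ i = j ∨ j = D.kmap v i := by
  unfold Proj lab kmap
  dsimp only
  omega

theorem valid_lab {v : V} {i j : ℤ} (h : j ≤ D.kmap v i) : D.Valid (D.lab v i j) := by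
  unfold kmap at h
  unfold Valid lab
  dsimp only
  omega

theorem exists_of_omega_eq_lab {v : V} {a b : ℤ} {L : V × ℕ} (h : a < b)
    (hL : D.omega L = D.lab v a b) : ∃ u < a, L = D.lab v u a ∧ D.kmap v u = b := by
  obtain ⟨w, m⟩ := L
  unfold omega lab at hL
  dsimp only at hL
  split_ifs at hL with h0
  · have := congrArg Prod.snd hL
    dsimp only at this
    omega
  · have h1 : (D.succ ^ (m : ℤ)) w = (D.succ ^ a) v := by simpa using congrArg Prod.fst hL
    have h2 : D.len w - m = (b - a).toNat := congrArg Prod.snd hL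
    have h3 : w = (D.succ ^ (a - m)) v := by
      rw [← neg_add_eq_sub, zpow_add, Equiv.Perm.mul_apply, ← h1, ← Equiv.Perm.mul_apply,
        ← zpow_add, neg_add_cancel, zpow_zero, Equiv.Perm.one_apply]
    refine ⟨a - m, by omega, ?_, ?_⟩
    · unfold lab
      rw [← h3]
      simp
    · unfold kmap
      rw [← h3]
      omega

theorem valid_eq_lab {L : V × ℕ} (hL : D.Valid L) :
    L = D.lab L.1 0 L.2 ∧ (L.2 : ℤ) ≤ D.kmap L.1 0 := by
  refine ⟨(D.lab_zero L.1 L.2).symm, ?_⟩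
  unfold Valid at hL
  simpa [kmap] using hL

variable (D)
variable [Finite V]

theorem finBound_one_iff : D.FinBound 1 ↔ ∀ v i j, i < j → j < D.kmap v i →
    D.kmap v i < D.kmap v j → D.kmap v j ≠ D.kmap v (D.kmap v i) := by
  rw [finBound_iff]
  constructor
  · intro h v i j hij hj hp heq
    have := h (D.lab v i j) (valid_lab hj.le)
    simp only [iterate_succ_apply', iterate_zero, id] at this
    rw [omega_lab hij, omega_lab hj, proj_lab hp.le, proj_lab hj.le] at this
    have := this (Or.inr heq)
    omega
  · intro h L hL
    obtain ⟨hLe, hle⟩ := valid_eq_lab hL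
    generalize (L.2 : ℤ) = j at *
    generalize L.1 = v at *
    have hp := D.isKupischMap v
    subst hLe
    intro h2
    by_contra h1
    have h0 : ¬ D.Proj (D.lab v 0 j) := fun h0 => h1 h0.omega
    have hj0 : 0 < j := by
      by_contra! hj
      exact h0 (Or.inl (by simp [lab]; omega))
    rw [proj_lab hj0.le] at h0
    have hj : j < D.kmap v 0 := by omega
    simp only [iterate_succ_apply', iterate_zero, id] at h1 h2
    rw [omega_lab hj0] at h1 h2
    rw [proj_lab hj.le] at h1
    rw [omega_lab hj, proj_lab (hp.mono hj0.le)] at h2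
    have := hp.mono hj0.le
    exact h v 0 j hj0 hj (by omega) (by omega)

theorem finBound_two_iff : D.FinBound 2 ↔ ∀ v i j, i < j → j < D.kmap v i →
    D.kmap v i < D.kmap v j → D.kmap v j < D.kmap v (D.kmap v i) →
      D.kmap v (D.kmap v i) ≠ D.kmap v (D.kmap v j) := by
  rw [finBound_iff]
  constructor
  · intro h v i j hij hj hp hp' heq
    have := h (D.lab v i j) (valid_lab hj.le)
    simp only [iterate_succ_apply', iterate_zero, id] at this
    rw [omega_lab hij, omega_lab hj, omega_lab hp, proj_lab hp.le, proj_lab hp'.le] at this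
    have := this (Or.inr heq)
    omega
  · intro h L hL
    obtain ⟨hLe, hle⟩ := valid_eq_lab hL
    generalize (L.2 : ℤ) = j at *
    generalize L.1 = v at *
    have hp := D.isKupischMap v
    subst hLe
    simp only [iterate_succ_apply', iterate_zero, id]
    intro h3
    by_contra h2
    have h1 : ¬ D.Proj (D.omega (D.lab v 0 j)) := fun h1 => h2 h1.omega
    have h0 : ¬ D.Proj (D.lab v 0 j) := fun h0 => h1 h0.omega
    have hj0 : 0 < j := by
      by_contra! hj
      exact h0 (Or.inl (by simp [lab]; omega))
    rw [proj_lab hj0.le] at h0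
    have hj : j < D.kmap v 0 := by omega
    have hm := hp.mono hj0.le
    have hm' := hp.mono hj.le
    rw [omega_lab hj0] at h1 h2 h3
    rw [proj_lab hj.le] at h1
    rw [omega_lab hj] at h2 h3
    rw [proj_lab hm] at h2
    rw [omega_lab (by omega), proj_lab hm'] at h3
    exact h v 0 j hj0 hj (by omega) (by omega) (by omega)

theorem delBound_one_iff : D.DelBound 1 ↔ ∀ v i, D.kmap v i < D.kmap v (i + 1) →
    i + 1 ∈ Set.range (D.kmap v) := by
  constructor
  · intro h v i hi
    have hp := D.isKupischMap v
    have h2 := hp.add_two_le i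
    have hS : ((D.succ ^ i) v, 1) = D.lab v i (i + 1) := by simp [lab]
    obtain ⟨n, hn, hd⟩ := h ((D.succ ^ i) v)
    rw [hS] at hd
    interval_cases n
    · simp only [iterate_succ_apply', iterate_zero, id] at hd
      rw [proj_lab (by omega)] at hd
      obtain hd | ⟨L, -, hL⟩ := hd
      · omega
      · obtain ⟨u, -, -, hu⟩ := exists_of_omega_eq_lab (by omega) hL
        exact ⟨u, hu⟩
    · simp only [iterate_succ_apply', iterate_zero, id] at hd
      rw [omega_lab (by omega), proj_lab (by omega)] at hd
      obtain hd | ⟨L, -, hL⟩ := hd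
      · omega
      · obtain ⟨u, hu, hL, -⟩ := exists_of_omega_eq_lab (by omega) hL
        obtain ⟨w, -, -, hw⟩ := exists_of_omega_eq_lab hu hL
        exact ⟨w, hw⟩
  · intro h v
    have hp := D.isKupischMap v
    have h2 := hp.add_two_le 0
    have hS : (v, 1) = D.lab v 0 1 := by simp [lab]
    rw [hS]
    by_cases heq : D.kmap v 0 = D.kmap v 1
    · refine ⟨1, le_rfl, Or.inl ?_⟩
      rw [iterate_one, omega_lab (by omega), proj_lab (by omega)]
      exact Or.inr heq
    · obtain ⟨u, hu⟩ := h v 0 (lt_of_le_of_ne (hp.mono (by omega)) heq)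
      have hu2 := hp.add_two_le u
      refine ⟨0, by omega, Or.inr ⟨D.lab v u 0, valid_lab (by omega), ?_⟩⟩
      simp only [iterate_succ_apply', iterate_zero, id]
      rw [omega_lab (by omega), hu, zero_add]

theorem delBound_two_iff : D.DelBound 2 ↔ ∀ v i, D.kmap v i < D.kmap v (i + 1) →
    D.kmap v (i + 1) ∈ Set.range (D.kmap v ∘ D.kmap v) := by
  constructor
  · intro h v i hi
    have hp := D.isKupischMap v
    have h2 := hp.add_two_le i
    have hS : ((D.succ ^ i) v, 1) = D.lab v i (i + 1) := by simp [lab]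
    obtain ⟨n, hn, hd⟩ := h ((D.succ ^ i) v)
    rw [hS] at hd
    interval_cases n
    · simp only [iterate_succ_apply', iterate_zero, id] at hd
      rw [proj_lab (by omega)] at hd
      obtain hd | ⟨L, -, hL⟩ := hd
      · omega
      · obtain ⟨u, -, -, hu⟩ := exists_of_omega_eq_lab (by omega) hL
        exact ⟨u, congrArg _ hu⟩
    · simp only [iterate_succ_apply', iterate_zero, id] at hd
      rw [omega_lab (by omega), proj_lab (by omega)] at hd
      obtain hd | ⟨L, -, hL⟩ := hd
      · omega
      · obtain ⟨u, hu, hL, -⟩ := exists_of_omega_eq_lab (by omega) hL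
        obtain ⟨w, -, -, hw⟩ := exists_of_omega_eq_lab hu hL
        exact ⟨w, congrArg _ hw⟩
    · simp only [iterate_succ_apply', iterate_zero, id] at hd
      rw [omega_lab (by omega), omega_lab (by omega), proj_lab (by omega)] at hd
      obtain hd | ⟨L, -, hL⟩ := hd
      · exact ⟨i, (hd.resolve_left (by omega)).symm⟩
      · obtain ⟨u, hu, hL, hu'⟩ := exists_of_omega_eq_lab (by omega) hL
        obtain ⟨w, hw, hL, -⟩ := exists_of_omega_eq_lab hu hL
        obtain ⟨x, -, -, hx⟩ := exists_of_omega_eq_lab hw hL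
        exact ⟨x, by rw [comp_apply, hx, hu']⟩
  · intro h v
    have hp := D.isKupischMap v
    have h2 := hp.add_two_le 0
    have hS : (v, 1) = D.lab v 0 1 := by simp [lab]
    rw [hS]
    by_cases heq : D.kmap v 0 = D.kmap v 1
    · refine ⟨1, by omega, Or.inl ?_⟩
      rw [iterate_one, omega_lab (by omega), proj_lab (by omega)]
      exact Or.inr heq
    · have hlt := lt_of_le_of_ne (hp.mono (show (0 : ℤ) ≤ 1 by omega)) heq
      obtain ⟨u, hu⟩ := h v 0 hlt
      rw [comp_apply, zero_add] at hu
      refine ⟨2, le_rfl, ?_⟩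
      simp only [iterate_succ_apply', iterate_zero, id]
      rw [omega_lab (show (0 : ℤ) < 1 by omega), omega_lab (by omega), proj_lab hlt.le]
      by_cases heq' : D.kmap v 1 = D.kmap v (D.kmap v 0)
      · exact Or.inl (Or.inr heq')
      have h1 := hp.mono (show 1 ≤ D.kmap v 0 by omega)
      have hu0 : u < 0 := by
        by_contra! hle
        have := hp.mono (hp.mono hle)
        omega
      have hpu0 : 0 < D.kmap v u := by
        by_contra! hle
        have := hp.mono hle
        omega
      have hpu : D.kmap v u < D.kmap v 0 := by
        refine lt_of_le_of_ne (hp.mono hu0.le) fun he => heq' ?_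
        rw [← hu, he]
      refine Or.inr ⟨D.lab v u 0, valid_lab hpu0.le, ?_⟩
      rw [omega_lab hu0, omega_lab hpu0, omega_lab hpu, hu]

theorem finBound_one_iff_delBound_one : D.FinBound 1 ↔ D.DelBound 1 := by
  rw [finBound_one_iff, delBound_one_iff]
  exact forall_congr' fun v => (D.isKupischMap v).no_projDim_two_iff

theorem finBound_two_iff_delBound_two : D.FinBound 2 ↔ D.DelBound 2 := by
  rw [finBound_two_iff, delBound_two_iff]
  exact forall_congr' fun v => (D.isKupischMap v).no_projDim_three_iff

end KupischData

end KupischData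

section FiniteLength

variable {A : Type} [Ring A] {M N : Type} [AddCommGroup M] [Module A M]
  [AddCommGroup N] [Module A N]

variable (A M) in
/-- The length of a module as a natural number. -/
def len : ℕ := (Module.length A M).toNat

theorem LinearEquiv.len_eq (e : M ≃ₗ[A] N) : len A M = len A N := by
  rw [len, e.length_eq, len]

variable [IsArtinianRing A] [Module.Finite A M]

theorem coe_len : (len A M : ℕ∞) = Module.length A M :=
  ENat.natCast_toNat Module.length_ne_top

theorem len_eq_ker_add {f : M →ₗ[A] N} (hf : Surjective f) :
    len A M = len A (LinearMap.ker f) + len A N := by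
  have : Module.Finite A N := Module.Finite.of_surjective f hf
  have h := Module.length_eq_add_of_exact (LinearMap.ker f).subtype f
    (Submodule.subtype_injective _) hf (LinearMap.exact_subtype_ker_map f)
  rw [← coe_len, ← coe_len, ← coe_len] at h
  exact_mod_cast h

theorem len_quotient (K : Submodule A M) : len A M = len A K + len A (M ⧸ K) := by
  have h := len_eq_ker_add K.mkQ_surjective
  rwa [(LinearEquiv.ofEq _ _ K.ker_mkQ).len_eq] at h

theorem len_eq_zero_iff : len A M = 0 ↔ Subsingleton M := by
  rw [← Module.length_eq_zero_iff (R := A), ← coe_len, Nat.cast_eq_zero]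

theorem len_pos_iff : 0 < len A M ↔ Nontrivial M := by
  rw [Nat.pos_iff_ne_zero, Ne, len_eq_zero_iff, not_subsingleton_iff_nontrivial]

theorem len_eq_one_iff : len A M = 1 ↔ IsSimpleModule A M := by
  rw [← Module.length_eq_one_iff, ← coe_len, Nat.cast_eq_one]

theorem len_lt_of_lt {K K' : Submodule A M} (h : K < K') : len A K < len A K' := by
  have h := Submodule.height_strictMono h
  rw [← Module.length_submodule, ← Module.length_submodule, ← coe_len, ← coe_len] at h
  exact_mod_cast h

end FiniteLength

section Uniserial

variable {A : Type} [Ring A] {M N : Type} [AddCommGroup M] [Module A M]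
  [AddCommGroup N] [Module A N]

variable (A M) in
/-- The submodules of `M` form a chain. -/
def Uniserial : Prop := ∀ K K' : Submodule A M, K ≤ K' ∨ K' ≤ K

theorem Uniserial.of_surjective (h : Uniserial A M) {f : M →ₗ[A] N} (hf : Surjective f) :
    Uniserial A N := fun K K' => by
  rw [← Submodule.comap_le_comap_iff_of_surjective hf,
    ← Submodule.comap_le_comap_iff_of_surjective hf (p := K')]
  exact h _ _

theorem Uniserial.of_injective (h : Uniserial A M) {f : N →ₗ[A] M} (hf : Injective f) :
    Uniserial A N := fun K K' => by
  rw [← Submodule.map_le_map_iff_of_injective hf, ← Submodule.map_le_map_iff_of_injective hf K']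
  exact h _ _

theorem Uniserial.submodule (h : Uniserial A M) (K : Submodule A M) : Uniserial A K :=
  h.of_injective K.subtype_injective

theorem Uniserial.isSmallSubmodule (h : Uniserial A M) {K : Submodule A M} (hK : K ≠ ⊤) :
    IsSmallSubmodule A K := fun K' hK' => by
  rcases h K K' with hle | hle
  · rwa [sup_eq_right.2 hle] at hK'
  · exact absurd ((sup_eq_left.2 hle).symm.trans hK') hK

theorem Uniserial.eq_top_of_not_le (h : Uniserial A M) {C K : Submodule A M} (hC : IsCoatom C)
    (hK : ¬ K ≤ C) : K = ⊤ :=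
  hC.2 K (lt_of_le_not_ge ((h K C).resolve_left hK) hK)

theorem Uniserial.isAtom_le (h : Uniserial A M) {S K : Submodule A M} (hS : IsAtom S)
    (hK : K ≠ ⊥) : S ≤ K := by
  rcases h S K with hle | hle
  · exact hle
  · exact ((hS.le_iff.1 hle).resolve_left hK).ge

theorem Uniserial.eq_of_len_eq [IsArtinianRing A] [Module.Finite A M] (h : Uniserial A M)
    {K K' : Submodule A M} (hKK' : len A K = len A K') : K = K' := by
  rcases h K K' with hle | hle
  · rcases hle.lt_or_eq with hlt | heq
    · exact absurd hKK' (len_lt_of_lt hlt).ne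
    · exact heq
  · rcases hle.lt_or_eq with hlt | heq
    · exact absurd hKK' (len_lt_of_lt hlt).ne'
    · exact heq.symm

/-- If the identity of a uniserial module of finite length is a finite sum of endomorphisms, one of
the summands is bijective. -/
theorem Uniserial.exists_bijective_of_sum_eq_id [IsArtinianRing A] [Module.Finite A M]
    [Nontrivial M] (h : Uniserial A M) {ι : Type} (s : Finset ι) (f : ι → M →ₗ[A] M)
    (hf : ∑ i ∈ s, f i = LinearMap.id) : ∃ i ∈ s, Bijective (f i) := by
  by_contra! hcon
  obtain ⟨S, hS, -⟩ := (eq_bot_or_exists_atom_le (⊤ : Submodule A M)).resolve_left top_ne_bot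
  have hle : ∀ i ∈ s, S ≤ LinearMap.ker (f i) := fun i hi => by
    refine h.isAtom_le hS fun hker => hcon i hi ?_
    exact IsArtinian.bijective_of_injective_endomorphism _ (LinearMap.ker_eq_bot.1 hker)
  refine hS.1 ((Submodule.eq_bot_iff _).2 fun x hx => ?_)
  have := congrArg (fun g => g x) hf
  simp only [LinearMap.sum_apply, LinearMap.id_apply] at this
  rw [← this]
  exact Finset.sum_eq_zero fun i hi => LinearMap.mem_ker.1 (hle i hi hx)

/-- A nonzero module that is a retract of a uniserial module is isomorphic to it. -/
theorem Uniserial.bijective_of_retract [Nontrivial N] (h : Uniserial A M) {a : N →ₗ[A] M}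
    {b : M →ₗ[A] N} (hab : b ∘ₗ a = LinearMap.id) : Bijective b := by
  have hba : ∀ x, b (a x) = x := fun x => congrArg (fun g => g x) hab
  refine ⟨?_, fun x => ⟨a x, hba x⟩⟩
  rw [← LinearMap.ker_eq_bot]
  rcases h (LinearMap.ker b) (LinearMap.range a) with hle | hle
  · refine (Submodule.eq_bot_iff _).2 fun y hy => ?_
    obtain ⟨x, rfl⟩ := hle hy
    rw [LinearMap.mem_ker, hba] at hy
    rw [hy, map_zero]
  · obtain ⟨x, hx⟩ := exists_ne (0 : N)
    have := hle ⟨x, rfl⟩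
    rw [LinearMap.mem_ker, hba] at this
    exact absurd this hx

variable (A) in
/-- `N` is a retract of `M`. -/
def IsRetract (N M : Type) [AddCommGroup M] [Module A M] [AddCommGroup N] [Module A N] : Prop :=
  ∃ (a : N →ₗ[A] M) (b : M →ₗ[A] N), b ∘ₗ a = LinearMap.id

theorem IsRetract.of_bijective {X : Type} [AddCommGroup X] [Module A X] {a : N →ₗ[A] X}
    {b : X →ₗ[A] N} (h : Bijective (b ∘ₗ a)) : IsRetract A N X := by
  let e := LinearEquiv.ofBijective _ h
  exact ⟨a, e.symm.toLinearMap ∘ₗ b, LinearMap.ext fun x => e.symm_apply_apply x⟩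

theorem Uniserial.retract_of_retract_pi [IsArtinianRing A] [Module.Finite A N] [Nontrivial N]
    (h : Uniserial A N) {ι : Type} [Fintype ι] {X : ι → ModuleCat.{0} A}
    (hN : IsRetract A N (Π i, X i)) : ∃ i, IsRetract A N (X i) := by
  obtain ⟨a, b, hab⟩ := hN
  obtain ⟨i, -, hi⟩ := h.exists_bijective_of_sum_eq_id Finset.univ
    (fun i => (b ∘ₗ LinearMap.single A (fun i => ↥(X i)) i) ∘ₗ (LinearMap.proj i ∘ₗ a)) (by
      ext x
      simp only [LinearMap.sum_apply, LinearMap.comp_apply, ← map_sum]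
      refine (congrArg b (Finset.univ_sum_single (a x))).trans (congrArg (fun g => g x) hab))
  exact ⟨i, IsRetract.of_bijective hi⟩

theorem Uniserial.retract_of_retract_prod [IsArtinianRing A] [Module.Finite A N] [Nontrivial N]
    (h : Uniserial A N) {X Y : Type} [AddCommGroup X] [Module A X] [AddCommGroup Y] [Module A Y]
    (hN : IsRetract A N (X × Y)) : IsRetract A N X ∨ IsRetract A N Y := by
  obtain ⟨a, b, hab⟩ := hN
  obtain ⟨i, -, hi⟩ := h.exists_bijective_of_sum_eq_id Finset.univ
    (fun i : Bool => cond i ((b ∘ₗ LinearMap.inl A X Y) ∘ₗ (LinearMap.fst A X Y ∘ₗ a))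
      ((b ∘ₗ LinearMap.inr A X Y) ∘ₗ (LinearMap.snd A X Y ∘ₗ a))) (by
      ext x
      refine Eq.trans ?_ (congrArg (fun g => g x) hab)
      simp [← map_add])
  cases i
  · exact Or.inr (IsRetract.of_bijective hi)
  · exact Or.inl (IsRetract.of_bijective hi)

/-- A nonzero finitely generated uniserial module is a quotient of one of the summands of the
regular module. -/
theorem Uniserial.exists_surjective [Module.Finite A M] [Nontrivial M]
    (h : Uniserial A M) {ι : Type} [Fintype ι] {X : ι → ModuleCat.{0} A} (e : A ≃ₗ[A] Π i, X i) :
    ∃ (i : ι) (f : X i →ₗ[A] M), Surjective f := by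
  obtain ⟨C, hC, -⟩ := (eq_top_or_exists_le_coatom (⊥ : Submodule A M)).resolve_left bot_ne_top
  obtain ⟨x, -, hx⟩ := SetLike.exists_of_lt hC.lt_top
  let g : (Π i, X i) →ₗ[A] M := LinearMap.toSpanSingleton A M x ∘ₗ e.symm.toLinearMap
  by_contra! hcon
  have hle : ∀ i, LinearMap.range (g ∘ₗ LinearMap.single A (fun i => ↥(X i)) i) ≤ C := fun i => by
    by_contra hi
    exact hcon i _ (LinearMap.range_eq_top.1 (h.eq_top_of_not_le hC hi))
  have hg : ∀ y, g y ∈ C := fun y => by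
    rw [← Finset.univ_sum_single y, map_sum]
    exact C.sum_mem fun i _ => hle i ⟨y i, rfl⟩
  refine hx ?_
  have := hg (e 1)
  simpa [g] using this

theorem IsRetract.trans {M N X : Type} [AddCommGroup M] [Module A M] [AddCommGroup N] [Module A N]
    [AddCommGroup X] [Module A X] (h : IsRetract A N M) (h' : IsRetract A M X) :
    IsRetract A N X := by
  obtain ⟨a, b, hab⟩ := h
  obtain ⟨c, d, hcd⟩ := h'
  exact ⟨c ∘ₗ a, b ∘ₗ d, by rw [LinearMap.comp_assoc, ← LinearMap.comp_assoc _ c, hcd,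
    LinearMap.id_comp, hab]⟩

theorem IsRetract.of_equiv (e : N ≃ₗ[A] M) : IsRetract A N M :=
  ⟨e.toLinearMap, e.symm.toLinearMap, by ext; simp⟩

theorem IsRetract.pi {ι : Type} (X : ι → ModuleCat.{0} A) (i : ι) : IsRetract A (X i) (Π i, X i) :=
  ⟨LinearMap.single A (fun i => ↥(X i)) i, LinearMap.proj i, by ext; simp⟩

theorem IsRetract.inl (M N : Type) [AddCommGroup M] [Module A M] [AddCommGroup N] [Module A N] :
    IsRetract A M (M × N) :=
  ⟨LinearMap.inl A M N, LinearMap.fst A M N, LinearMap.fst_comp_inl A M N⟩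

theorem IsRetract.inr (M N : Type) [AddCommGroup M] [Module A M] [AddCommGroup N] [Module A N] :
    IsRetract A N (M × N) :=
  ⟨LinearMap.inr A M N, LinearMap.snd A M N, LinearMap.snd_comp_inr A M N⟩

theorem IsRetract.projective (h : IsRetract A N M) [Module.Projective A M] :
    Module.Projective A N := by
  obtain ⟨a, b, hab⟩ := h
  exact Module.Projective.of_split a b hab

theorem isDirectSummandOf_iff {N M : ModuleCat.{0} A} :
    IsDirectSummandOf A N M ↔ IsRetract A N M := by
  constructor
  · rintro ⟨C, ⟨e⟩⟩
    exact (IsRetract.inl N C).trans (.of_equiv e.symm)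
  · rintro ⟨a, b, hab⟩
    have hba : ∀ x, b (a x) = x := fun x => congrArg (fun g => g x) hab
    have hker : ∀ x, (LinearMap.id - a ∘ₗ b : M →ₗ[A] M) x ∈ LinearMap.ker b := fun x => by
      simp [hba]
    refine ⟨ModuleCat.of A (LinearMap.ker b), ⟨LinearEquiv.ofLinearMap
      (b.prod ((LinearMap.id - a ∘ₗ b).codRestrict (LinearMap.ker b) hker))
      (a.coprod (LinearMap.ker b).subtype)
      (LinearMap.ext fun ⟨x, y, hy⟩ => ?_) (LinearMap.ext fun x => ?_)⟩⟩
    · rw [LinearMap.mem_ker] at hy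
      refine Prod.ext ?_ (Subtype.ext ?_) <;> simp [hba, hy]
    · simp

end Uniserial

section Decomposition

variable {A : Type} [Ring A]

/-- Every finitely generated module over an Artinian ring is a finite direct sum of
indecomposable modules. -/
theorem exists_indecomposable_decomposition [IsArtinianRing A] (M : Type) [AddCommGroup M]
    [Module A M] [Module.Finite A M] :
    ∃ (ι : Type) (_ : Fintype ι) (X : ι → ModuleCat.{0} A),
      (∀ i, Module.Finite A (X i) ∧ IndecomposableModule A (X i)) ∧
        Nonempty (M ≃ₗ[A] Π i, X i) := by
  induction hn : len A M using Nat.strong_induction_on generalizing M with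
  | _ n ih =>
  subst hn
  rcases subsingleton_or_nontrivial M with hM | hM
  · refine ⟨Empty, inferInstance, fun _ => ModuleCat.of A M, fun i => i.elim, ⟨?_⟩⟩
    exact LinearEquiv.ofSubsingleton _ _
  by_cases hI : IndecomposableModule A (ModuleCat.of A M)
  · refine ⟨Unit, inferInstance, fun _ => ModuleCat.of A M, fun _ => ⟨‹_›, hI⟩, ⟨?_⟩⟩
    exact (LinearEquiv.funUnique Unit A M).symm
  · obtain ⟨N, N', hc, hN, hN'⟩ : ∃ N N' : Submodule A M, IsCompl N N' ∧ N ≠ ⊥ ∧ N ≠ ⊤ := by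
      by_contra! hcon
      exact hI ⟨hM, fun N N' hc => or_iff_not_imp_left.2 (hcon N N' hc)⟩
    have hN'' : N' ≠ ⊤ := fun h => hN (by simpa [h] using hc.inf_eq_bot)
    have hlt : ∀ K : Submodule A M, K ≠ ⊤ → len A K < len A M := fun K hK => by
      rw [← (Submodule.topEquiv (R := A) (M := M)).len_eq]
      exact len_lt_of_lt hK.lt_top
    obtain ⟨ι, _, X, hX, ⟨e⟩⟩ := ih _ (hlt N hN') N rfl
    obtain ⟨ι', _, X', hX', ⟨e'⟩⟩ := ih _ (hlt N' hN'') N' rfl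
    refine ⟨ι ⊕ ι', inferInstance, Sum.elim X X', ?_, ⟨?_⟩⟩
    · rintro (i | i)
      · exact hX i
      · exact hX' i
    · exact (N.prodEquivOfIsCompl N' hc).symm ≪≫ₗ (e.prodCongr e') ≪≫ₗ
        (LinearEquiv.sumPiEquivProdPi A ι ι' fun i => ↥(Sum.elim X X' i)).symm

end Decomposition

section Syzygy

variable {A : Type} [Ring A]

theorem IsSmallSubmodule.map {M N : Type} [AddCommGroup M] [Module A M] [AddCommGroup N]
    [Module A N] {K : Submodule A M} (hK : IsSmallSubmodule A K) (g : M →ₗ[A] N) :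
    IsSmallSubmodule A (K.map g) := by
  intro L hL
  have h1 : K ⊔ L.comap g = ⊤ := by
    refine eq_top_iff.2 fun x _ => ?_
    obtain ⟨_, ⟨n, hn, rfl⟩, l, hl, hx⟩ := Submodule.mem_sup.1 (hL ▸ Submodule.mem_top : g x ∈ _)
    refine Submodule.mem_sup.2 ⟨n, hn, x - n, ?_, by abel⟩
    rw [Submodule.mem_comap, map_sub, ← hx]
    simpa using hl
  have h2 : K.map g ≤ L := by
    rw [Submodule.map_le_iff_le_comap, hK _ h1]
    exact le_top
  rwa [sup_eq_right.2 h2] at hL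

theorem IsSmallSubmodule.finset_sup {M ι : Type} [AddCommGroup M] [Module A M] (s : Finset ι)
    {K : ι → Submodule A M} (hK : ∀ i, IsSmallSubmodule A (K i)) :
    IsSmallSubmodule A (s.sup K) := by
  induction s using Finset.induction_on with
  | empty => intro L hL; simpa using hL
  | insert i s _ ih =>
    intro L hL
    rw [Finset.sup_insert, sup_assoc] at hL
    exact ih _ (hK i _ hL)

theorem IsSmallSubmodule.mono {M : Type} [AddCommGroup M] [Module A M] {K K' : Submodule A M}
    (hK' : IsSmallSubmodule A K') (h : K ≤ K') : IsSmallSubmodule A K := fun L hL =>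
  hK' L (eq_top_iff.2 (hL.ge.trans (sup_le_sup_right h L)))

/-- Projective covers are unique up to isomorphism. -/
theorem exists_equiv_of_small_ker {P Q M : Type} [AddCommGroup P] [Module A P] [AddCommGroup Q]
    [Module A Q] [AddCommGroup M] [Module A M] [Module.Projective A P] [Module.Projective A Q]
    {f : P →ₗ[A] M} {g : Q →ₗ[A] M} (hf : Surjective f) (hg : Surjective g)
    (hf' : IsSmallSubmodule A (LinearMap.ker f)) (hg' : IsSmallSubmodule A (LinearMap.ker g)) :
    ∃ e : P ≃ₗ[A] Q, ∀ x, g (e x) = f x := by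
  obtain ⟨h, hh⟩ := Module.projective_lifting_property g f hg
  have hgh : ∀ x, g (h x) = f x := fun x => congrArg (fun k => k x) hh
  have hsurj : Surjective h := by
    refine LinearMap.range_eq_top.1 (hg' _ (eq_top_iff.2 fun y _ => ?_))
    obtain ⟨x, hx⟩ := hf (g y)
    refine Submodule.mem_sup.2 ⟨y - h x, ?_, h x, ⟨x, rfl⟩, by abel⟩
    rw [LinearMap.mem_ker, map_sub, hgh, hx, sub_self]
  obtain ⟨s, hs⟩ := LinearMap.exists_rightInverse_of_surjective h (LinearMap.range_eq_top.2 hsurj)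
  have hhs : ∀ y, h (s y) = y := fun y => congrArg (fun k => k y) hs
  have hker : LinearMap.range s = ⊤ := by
    refine hf' _ (eq_top_iff.2 fun x _ => ?_)
    refine Submodule.mem_sup.2 ⟨x - s (h x), ?_, s (h x), ⟨_, rfl⟩, by abel⟩
    rw [LinearMap.mem_ker, map_sub, ← hgh, ← hgh (s (h x)), hhs, sub_self]
  have hinj : Injective h := by
    intro x y hxy
    obtain ⟨a, rfl⟩ := LinearMap.range_eq_top.1 hker x
    obtain ⟨b, rfl⟩ := LinearMap.range_eq_top.1 hker y
    rw [hhs, hhs] at hxy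
    rw [hxy]
  exact ⟨LinearEquiv.ofBijective h ⟨hinj, hsurj⟩, hgh⟩

theorem IsSyzygyOf.nonempty_equiv {N M N' M' : ModuleCat.{0} A} (h : IsSyzygyOf A N M)
    (h' : IsSyzygyOf A N' M') (e : M ≃ₗ[A] M') : Nonempty (N ≃ₗ[A] N') := by
  obtain ⟨P, f, _, _, hf, hfs, ⟨eN⟩⟩ := h
  obtain ⟨Q, g, _, _, hg, hgs, ⟨eN'⟩⟩ := h'
  have hker : LinearMap.ker (e.toLinearMap ∘ₗ f) = LinearMap.ker f := by
    rw [LinearMap.ker_comp, e.ker, Submodule.comap_bot]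
  obtain ⟨E, hE⟩ := exists_equiv_of_small_ker (f := e.toLinearMap ∘ₗ f) (e.surjective.comp hf) hg
    (hker ▸ hfs) hgs
  have hmap : (LinearMap.ker f).map E.toLinearMap = LinearMap.ker g := by
    ext y
    obtain ⟨x, rfl⟩ := E.surjective y
    have hx : g (E x) = e (f x) := hE x
    simp [hx]
  exact ⟨eN ≪≫ₗ E.ofSubmodules _ _ hmap ≪≫ₗ eN'.symm⟩

theorem IsSyzygyOf.congr {N M N' M' : ModuleCat.{0} A} (h : IsSyzygyOf A N M)
    (eN : N ≃ₗ[A] N') (eM : M ≃ₗ[A] M') : IsSyzygyOf A N' M' := by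
  obtain ⟨P, f, hP, hP', hf, hfs, ⟨e⟩⟩ := h
  have hker : LinearMap.ker (eM.toLinearMap ∘ₗ f) = LinearMap.ker f := by
    rw [LinearMap.ker_comp, eM.ker, Submodule.comap_bot]
  exact ⟨P, eM.toLinearMap ∘ₗ f, hP, hP', eM.surjective.comp hf, hker ▸ hfs,
    ⟨eN.symm ≪≫ₗ e ≪≫ₗ LinearEquiv.ofEq _ _ hker.symm⟩⟩

theorem projective_of_subsingleton {M : Type} [AddCommGroup M] [Module A M] [Subsingleton M] :
    Module.Projective A M :=
  Module.Projective.of_free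

theorem projective_pi {ι : Type} [Fintype ι] {X : ι → ModuleCat.{0} A}
    (h : ∀ i, Module.Projective A (X i)) : Module.Projective A (Π i, X i) :=
  Module.Projective.of_equiv' (DFinsupp.linearEquivFunOnFintype (R := A) (M := fun i => ↥(X i)))

theorem IsSyzygyOf.pi {ι : Type} [Fintype ι] {N M : ι → ModuleCat.{0} A}
    (h : ∀ i, IsSyzygyOf A (N i) (M i)) :
    IsSyzygyOf A (ModuleCat.of A (Π i, N i)) (ModuleCat.of A (Π i, M i)) := by
  choose P f hP hP' hf hfs e using h
  let F : (Π i, P i) →ₗ[A] (Π i, M i) := LinearMap.pi fun i => f i ∘ₗ LinearMap.proj i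
  have hF : ∀ x i, F x i = f i (x i) := fun _ _ => rfl
  refine ⟨ModuleCat.of A (Π i, P i), F, projective_pi hP, Module.Finite.pi, ?_, ?_, ⟨?_⟩⟩
  · intro y
    choose x hx using fun i => hf i (y i)
    exact ⟨x, funext hx⟩
  · refine (IsSmallSubmodule.finset_sup Finset.univ fun i =>
      (hfs i).map (LinearMap.single A (fun i => ↥(P i)) i)).mono fun x hx => ?_
    rw [← Finset.univ_sum_single x]
    refine Submodule.sum_mem _ fun i hi => Finset.le_sup
      (f := fun i => (LinearMap.ker (f i)).map (LinearMap.single A (fun i => ↥(P i)) i)) hi ?_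
    exact ⟨x i, by rw [SetLike.mem_coe, LinearMap.mem_ker, ← hF, LinearMap.mem_ker.1 hx]; rfl, rfl⟩
  · refine (LinearEquiv.piCongrRight fun i => (e i).some) ≪≫ₗ ?_
    exact
      { toFun := fun x => ⟨fun i => (x i).1, funext fun i => (x i).2⟩
        invFun := fun x i => ⟨x.1 i, congrFun x.2 i⟩
        map_add' := fun _ _ => rfl
        map_smul' := fun _ _ => rfl
        left_inv := fun _ => rfl
        right_inv := fun _ => rfl }

theorem isNthSyzygyOf_iff {X : ℕ → ModuleCat.{0} A} (hX : ∀ n, IsSyzygyOf A (X (n + 1)) (X n))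
    {M : ModuleCat.{0} A} (e : M ≃ₗ[A] X 0) (n : ℕ) (N : ModuleCat.{0} A) :
    IsNthSyzygyOf A n N M ↔ Nonempty (N ≃ₗ[A] X n) := by
  induction n generalizing N with
  | zero => exact ⟨fun ⟨h⟩ => ⟨h ≪≫ₗ e⟩, fun ⟨h⟩ => ⟨h ≪≫ₗ e.symm⟩⟩
  | succ n ih =>
    constructor
    · rintro ⟨K, hK, hN⟩
      exact hN.nonempty_equiv (hX n) ((ih K).1 hK).some
    · rintro ⟨h⟩
      exact ⟨X n, (ih _).2 ⟨LinearEquiv.refl A _⟩, (hX n).congr h.symm (LinearEquiv.refl A _)⟩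

end Syzygy

section DimensionBounds

theorem sInf_image_natCast_le_iff {s : Set ℕ} {d : ℕ} :
    sInf ((fun n : ℕ => (n : ℕ∞)) '' s) ≤ d ↔ ∃ n ≤ d, n ∈ s := by
  constructor
  · intro h
    have hne : ((fun n : ℕ => (n : ℕ∞)) '' s).Nonempty := by
      by_contra hemp
      rw [Set.not_nonempty_iff_eq_empty.1 hemp, sInf_empty] at h
      exact absurd h (by simp)
    obtain ⟨n, hn, heq⟩ := csInf_mem hne
    exact ⟨n, Nat.cast_le.1 (heq.trans_le h), hn⟩
  · rintro ⟨n, hnd, hn⟩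
    exact (sInf_le (Set.mem_image_of_mem _ hn)).trans (Nat.cast_le.2 hnd)

end DimensionBounds

section Model

/-- The indecomposable projective modules `P v` of a ring all of whose finitely generated modules
are direct sums of uniserial modules, and which has no simple projective module. -/
structure NakayamaModel (A : Type) [Ring A] where
  V : Type
  P : V → ModuleCat.{0} A
  finite_V : Finite V
  projective : ∀ v, Module.Projective A (P v)
  finite : ∀ v, Module.Finite A (P v)
  two_le : ∀ v, 2 ≤ len A (P v)
  uniserial : ∀ v, Uniserial A (P v)
  eq_of_equiv : ∀ {v w}, (P v ≃ₗ[A] P w) → v = w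
  ι : Type
  fintype_ι : Fintype ι
  vertex : ι → V
  vertex_surjective : Surjective vertex
  equiv : A ≃ₗ[A] Π i, P (vertex i)
  exists_decomposition : ∀ M : ModuleCat.{0} A, Module.Finite A M →
    ∃ (κ : Type) (_ : Fintype κ) (X : κ → ModuleCat.{0} A),
      (∀ k, Module.Finite A (X k) ∧ Nontrivial (X k) ∧ Uniserial A (X k)) ∧
        Nonempty (M ≃ₗ[A] Π k, X k)

variable {A : Type} [Ring A]

theorem nonempty_nakayamaModel [IsArtinianRing A]
    (hU : ∀ M : ModuleCat.{0} A, Module.Finite A M → IndecomposableModule A M →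
      IsUniserialModule A M)
    (hS : ∀ M : ModuleCat.{0} A, IsSimpleModule A M → ¬ Module.Projective A M) :
    Nonempty (NakayamaModel A) := by
  obtain ⟨ι, _, X, hX, ⟨e⟩⟩ := exists_indecomposable_decomposition (A := A) A
  let s : Setoid ι :=
    { r := fun i j => Nonempty (X i ≃ₗ[A] X j)
      iseqv := ⟨fun _ => ⟨LinearEquiv.refl A _⟩, fun ⟨f⟩ => ⟨f.symm⟩,
        fun ⟨f⟩ ⟨g⟩ => ⟨f ≪≫ₗ g⟩⟩ }
  have hproj : ∀ i, Module.Projective A (X i) := fun i =>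
    Module.Projective.of_split (e.symm.toLinearMap ∘ₗ LinearMap.single A (fun i => ↥(X i)) i)
      (LinearMap.proj i ∘ₗ e.toLinearMap) (by ext; simp)
  have hfin := fun i => (hX i).1
  refine ⟨{
    V := Quotient s
    P := fun v => X v.out
    finite_V := inferInstance
    projective := fun v => hproj _
    finite := fun v => hfin _
    two_le := fun v => ?_
    uniserial := fun v => hU _ (hX _).1 (hX _).2
    eq_of_equiv := fun {v w} f => Quotient.out_equiv_out.1 ⟨f⟩
    ι := ι
    fintype_ι := inferInstance
    vertex := fun i => ⟦i⟧
    vertex_surjective := Quotient.mk_surjective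
    equiv := e ≪≫ₗ LinearEquiv.piCongrRight fun i => (Quotient.mk_out (s := s) i).some.symm
    exists_decomposition := fun M _ => ?_ }⟩
  · have := (hX v.out).2.1
    have h0 : 0 < len A (X v.out) := len_pos_iff.2 inferInstance
    have h1 : len A (X v.out) ≠ 1 := fun h => hS _ (len_eq_one_iff.1 h) (hproj _)
    omega
  · obtain ⟨κ, hκ, Y, hY, hM⟩ := exists_indecomposable_decomposition (A := A) M
    exact ⟨κ, hκ, Y, fun k => ⟨(hY k).1, (hY k).2.1, hU _ (hY k).1 (hY k).2⟩, hM⟩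

theorem exists_submodule_len_eq [IsArtinianRing A] (M : Type) [AddCommGroup M] [Module A M]
    [Module.Finite A M] {r : ℕ} (hr : r ≤ len A M) : ∃ K : Submodule A M, len A K = r := by
  induction hn : len A M generalizing M with
  | zero =>
    refine ⟨⊥, ?_⟩
    rw [len_eq_zero_iff.2 inferInstance]
    omega
  | succ n ih =>
    rcases hr.eq_or_lt with rfl | hlt
    · exact ⟨⊤, Submodule.topEquiv.len_eq⟩
    have : Nontrivial M := len_pos_iff.1 (by omega : 0 < len A M)
    obtain ⟨C, hC, -⟩ := (eq_top_or_exists_le_coatom (⊥ : Submodule A M)).resolve_left bot_ne_top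
    have h1 := len_quotient C
    rw [len_eq_one_iff.2 (isSimpleModule_iff_isCoatom.2 hC)] at h1
    obtain ⟨K, hK⟩ := ih C (by omega) (by omega)
    exact ⟨K.map C.subtype, by
      rw [← hK, (Submodule.equivMapOfInjective C.subtype C.subtype_injective K).len_eq]⟩

namespace NakayamaModel

variable (D : NakayamaModel A)

attribute [instance] finite_V projective finite fintype_ι

instance [IsArtinianRing A] (v : D.V) : Nontrivial (D.P v) :=
  len_pos_iff.1 (lt_of_lt_of_le two_pos (D.two_le v))

theorem exists_cover {M : Type} [AddCommGroup M] [Module A M] [Module.Finite A M] [Nontrivial M]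
    (h : Uniserial A M) : ∃ (v : D.V) (f : D.P v →ₗ[A] M), Surjective f := by
  obtain ⟨i, f, hf⟩ := h.exists_surjective D.equiv
  exact ⟨D.vertex i, f, hf⟩

variable {D}

theorem isSmallSubmodule_ker {M : Type} [AddCommGroup M] [Module A M] [Nontrivial M] {v : D.V}
    {f : D.P v →ₗ[A] M} (hf : Surjective f) : IsSmallSubmodule A (LinearMap.ker f) := by
  refine (D.uniserial v).isSmallSubmodule fun h => ?_
  obtain ⟨x, hx⟩ := exists_ne (0 : M)
  obtain ⟨y, rfl⟩ := hf x
  exact hx (LinearMap.mem_ker.1 (h ▸ Submodule.mem_top))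

theorem vertex_unique {M : Type} [AddCommGroup M] [Module A M] [Nontrivial M] {v w : D.V}
    {f : D.P v →ₗ[A] M} {g : D.P w →ₗ[A] M} (hf : Surjective f) (hg : Surjective g) : v = w := by
  obtain ⟨e, -⟩ := exists_equiv_of_small_ker hf hg (isSmallSubmodule_ker hf)
    (isSmallSubmodule_ker hg)
  exact D.eq_of_equiv e

theorem equiv_of_surjective [IsArtinianRing A] {M N : Type} [AddCommGroup M] [Module A M]
    [AddCommGroup N] [Module A N] {v : D.V} {f : D.P v →ₗ[A] M} {g : D.P v →ₗ[A] N}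
    (hf : Surjective f)
    (hg : Surjective g) (h : len A M = len A N) : Nonempty (M ≃ₗ[A] N) := by
  have hker : LinearMap.ker f = LinearMap.ker g := by
    refine (D.uniserial v).eq_of_len_eq ?_
    have h1 := len_eq_ker_add hf
    have h2 := len_eq_ker_add hg
    omega
  exact ⟨(f.quotKerEquivOfSurjective hf).symm ≪≫ₗ Submodule.quotEquivOfEq _ _ hker ≪≫ₗ
    g.quotKerEquivOfSurjective hg⟩

/-- Uniserial modules of the same length containing a common simple module are isomorphic. -/
theorem equiv_of_simple_embeddings [IsArtinianRing A] (D : NakayamaModel A) {X Y Z : Type}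
    [AddCommGroup X] [Module A X] [AddCommGroup Y] [Module A Y] [AddCommGroup Z] [Module A Z]
    [Module.Finite A X] [Module.Finite A Y]
    [IsSimpleModule A Z] (hX : Uniserial A X) (hY : Uniserial A Y) {i : Z →ₗ[A] X}
    {j : Z →ₗ[A] Y} (hi : Injective i) (hj : Injective j) (hlen : len A X = len A Y) :
    Nonempty (X ≃ₗ[A] Y) := by
  let R := LinearMap.range (i.prod (-j))
  obtain ⟨κ, _, U, hU, ⟨e⟩⟩ := D.exists_decomposition (ModuleCat.of A ((X × Y) ⧸ R)) inferInstance
  let a : X →ₗ[A] (X × Y) ⧸ R := R.mkQ ∘ₗ LinearMap.inl A X Y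
  let b : Y →ₗ[A] (X × Y) ⧸ R := R.mkQ ∘ₗ LinearMap.inr A X Y
  have hab : ∀ z, a (i z) = b (j z) := fun z =>
    (Submodule.Quotient.eq R).2 ⟨z, by simp⟩
  have ha : ∀ x, a x = 0 → x = 0 := fun x hx => by
    obtain ⟨z, hz⟩ := (Submodule.Quotient.mk_eq_zero R).1 hx
    have h1 : i z = x := congrArg Prod.fst hz
    have h2 : -j z = 0 := congrArg Prod.snd hz
    rw [neg_eq_zero, map_eq_zero_iff j hj] at h2
    rw [← h1, h2, map_zero]
  have := IsSimpleModule.nontrivial A Z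
  obtain ⟨z, hz⟩ := exists_ne (0 : Z)
  obtain ⟨k, hk⟩ : ∃ k, e (a (i z)) k ≠ 0 := by
    by_contra! hcon
    refine hz ((map_eq_zero_iff i hi).1 (ha _ ?_))
    exact e.map_eq_zero_iff.1 (funext hcon)
  have := (hU k).1
  let c : ((X × Y) ⧸ R) →ₗ[A] U k := LinearMap.proj k ∘ₗ e.toLinearMap
  have aux : ∀ {W : Type} [AddCommGroup W] [Module A W] (_ : Uniserial A W) {w : Z →ₗ[A] W}
      (_ : Injective w) (g : W →ₗ[A] U k), g (w z) ≠ 0 → Injective g := by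
    intro W _ _ hW w hw g hg
    rw [← LinearMap.ker_eq_bot]
    by_contra hne
    have hat : IsAtom (LinearMap.range w) := by
      rw [← isSimpleModule_iff_isAtom]
      exact IsSimpleModule.congr (LinearEquiv.ofInjective w hw).symm
    exact hg (hW.isAtom_le hat hne ⟨z, rfl⟩)
  have h1 : Injective (c ∘ₗ a) := aux hX hi _ hk
  have h2 : Injective (c ∘ₗ b) := aux hY hj _ (by rw [LinearMap.comp_apply, ← hab]; exact hk)
  let e1 := LinearEquiv.ofInjective _ h1
  let e2 := LinearEquiv.ofInjective _ h2
  have heq : LinearMap.range (c ∘ₗ a) = LinearMap.range (c ∘ₗ b) :=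
    (hU k).2.2.eq_of_len_eq (by rw [← e1.len_eq, ← e2.len_eq, hlen])
  exact ⟨e1 ≪≫ₗ LinearEquiv.ofEq _ _ heq ≪≫ₗ e2.symm⟩

theorem len_range_comp_add_one [IsArtinianRing A] {M : Type} [AddCommGroup M] [Module A M]
    [Nontrivial M] {v w : D.V} {f : D.P v →ₗ[A] M} (hf : Surjective f) {g : D.P w →ₗ[A] D.P v}
    (hg : IsCoatom (LinearMap.range g)) : len A (LinearMap.range (f ∘ₗ g)) + 1 = len A M := by
  have : Module.Finite A M := Module.Finite.of_surjective f hf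
  have hle : LinearMap.ker f ≤ LinearMap.range g := by
    by_contra h
    have htop := (D.uniserial v).eq_top_of_not_le hg h
    exact hg.1 (isSmallSubmodule_ker hf _ (by rw [htop, top_sup_eq]))
  have hco : IsCoatom (LinearMap.range (f ∘ₗ g)) := by
    rwa [← Submodule.isCoatom_comap_iff hf, LinearMap.range_comp, Submodule.comap_map_eq,
      sup_eq_left.2 hle]
  have h := len_quotient (LinearMap.range (f ∘ₗ g))
  rw [len_eq_one_iff.2 (isSimpleModule_iff_isCoatom.2 hco)] at h
  exact h.symm

variable [IsArtinianRing A] (D)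

theorem exists_isCoatom_range (v : D.V) :
    ∃ (w : D.V) (g : D.P w →ₗ[A] D.P v), IsCoatom (LinearMap.range g) := by
  obtain ⟨C, hC, -⟩ :=
    (eq_top_or_exists_le_coatom (⊥ : Submodule A (D.P v))).resolve_left bot_ne_top
  have h := len_quotient C
  rw [len_eq_one_iff.2 (isSimpleModule_iff_isCoatom.2 hC)] at h
  have h2 := D.two_le v
  have : Nontrivial C := len_pos_iff.1 (by omega : 0 < len A C)
  obtain ⟨w, f, hf⟩ := D.exists_cover ((D.uniserial v).submodule C)
  refine ⟨w, C.subtype ∘ₗ f, ?_⟩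
  rwa [LinearMap.range_comp, LinearMap.range_eq_top.2 hf, Submodule.map_top,
    Submodule.range_subtype]

theorem exists_submodule_len_add_eq (L : D.V × ℕ) :
    ∃ K : Submodule A (D.P L.1), L.2 ≤ len A (D.P L.1) → len A K + L.2 = len A (D.P L.1) := by
  obtain ⟨K, hK⟩ := exists_submodule_len_eq (A := A) (D.P L.1) (Nat.sub_le (len A (D.P L.1)) L.2)
  exact ⟨K, by omega⟩

/-- The submodule of `P v` with quotient of length `m`. -/
def sub (L : D.V × ℕ) : Submodule A (D.P L.1) := (D.exists_submodule_len_add_eq L).choose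

/-- The uniserial module with projective cover `P v` and length `m`. -/
def U (L : D.V × ℕ) : ModuleCat.{0} A := ModuleCat.of A (D.P L.1 ⧸ D.sub L)

/-- The projection of `P v` onto its quotient of length `m`. -/
def proj (L : D.V × ℕ) : D.P L.1 →ₗ[A] D.U L := (D.sub L).mkQ

variable {D}

theorem proj_surjective (L : D.V × ℕ) : Surjective (D.proj L) := (D.sub L).mkQ_surjective

instance (L : D.V × ℕ) : Module.Finite A (D.U L) :=
  Module.Finite.of_surjective _ (D.proj_surjective L)

theorem uniserial_U (L : D.V × ℕ) : Uniserial A (D.U L) :=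
  (D.uniserial L.1).of_surjective (D.proj_surjective L)

theorem len_ker_proj {L : D.V × ℕ} (h : L.2 ≤ len A (D.P L.1)) :
    len A (LinearMap.ker (D.proj L)) + L.2 = len A (D.P L.1) := by
  have hker : LinearMap.ker (D.proj L) = D.sub L := Submodule.ker_mkQ _
  rw [hker]
  exact (D.exists_submodule_len_add_eq L).choose_spec h

theorem len_U {L : D.V × ℕ} (h : L.2 ≤ len A (D.P L.1)) : len A (D.U L) = L.2 := by
  have h1 := len_ker_proj h
  have h2 := len_eq_ker_add (D.proj_surjective L)
  omega

variable (D) in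
/-- The projective cover of the radical of `P v`. -/
def next (v : D.V) : D.V := (D.exists_isCoatom_range v).choose

theorem next_injective : Injective D.next := by
  intro v w hvw
  obtain ⟨g, hg⟩ := (D.exists_isCoatom_range v).choose_spec
  obtain ⟨g', hg'⟩ : ∃ g' : D.P (D.next v) →ₗ[A] D.P w, IsCoatom (LinearMap.range g') := by
    rw [hvw]
    exact (D.exists_isCoatom_range w).choose_spec
  change D.P (D.next v) →ₗ[A] D.P v at g
  have hv : len A (D.U (v, 2)) = 2 := len_U (D.two_le v)
  have hw : len A (D.U (w, 2)) = 2 := len_U (D.two_le w)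
  have : Nontrivial (D.U (v, 2)) := len_pos_iff.1 (by omega : 0 < len A (D.U (v, 2)))
  have : Nontrivial (D.U (w, 2)) := len_pos_iff.1 (by omega : 0 < len A (D.U (w, 2)))
  have h1 := len_range_comp_add_one (D.proj_surjective (v, 2)) hg
  have h2 := len_range_comp_add_one (D.proj_surjective (w, 2)) hg'
  rw [hv] at h1
  rw [hw] at h2
  obtain ⟨e⟩ := equiv_of_surjective (LinearMap.surjective_rangeRestrict (D.proj (v, 2) ∘ₗ g))
    (LinearMap.surjective_rangeRestrict (D.proj (w, 2) ∘ₗ g')) (by omega)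
  have : IsSimpleModule A (LinearMap.range (D.proj (v, 2) ∘ₗ g)) :=
    len_eq_one_iff.1 (by omega)
  obtain ⟨e'⟩ := D.equiv_of_simple_embeddings (D.uniserial_U (v, 2)) (D.uniserial_U (w, 2))
    (Submodule.subtype_injective _) (j := Submodule.subtype _ ∘ₗ e.toLinearMap)
    ((Submodule.subtype_injective _).comp e.injective) (hv.trans hw.symm)
  exact vertex_unique (f := e'.toLinearMap ∘ₗ D.proj (v, 2))
    (e'.surjective.comp (D.proj_surjective (v, 2))) (D.proj_surjective (w, 2))

variable (D) in
/-- The cyclic orientation of the vertices. -/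
def succ : Equiv.Perm D.V :=
  Equiv.ofBijective D.next (Finite.injective_iff_bijective.1 next_injective)

theorem exists_len_range_add_eq (v : D.V) (m : ℕ) (hm : m ≤ len A (D.P v)) :
    ∃ g : D.P ((D.succ ^ m) v) →ₗ[A] D.P v, len A (LinearMap.range g) + m = len A (D.P v) := by
  induction m with
  | zero =>
    rw [pow_zero, Equiv.Perm.one_apply]
    exact ⟨LinearMap.id, by rw [LinearMap.range_id, Submodule.topEquiv.len_eq, add_zero]⟩
  | succ m ih =>
    obtain ⟨g, hg⟩ := ih (by omega)
    obtain ⟨h, hh⟩ : ∃ h : D.P ((D.succ ^ (m + 1)) v) →ₗ[A] D.P ((D.succ ^ m) v),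
        IsCoatom (LinearMap.range h) := by
      rw [pow_succ', Equiv.Perm.mul_apply]
      exact (D.exists_isCoatom_range _).choose_spec
    have : Nontrivial (LinearMap.range g) :=
      len_pos_iff.1 (by omega : 0 < len A (LinearMap.range g))
    have h1 := len_range_comp_add_one g.surjective_rangeRestrict hh
    rw [(Submodule.equivMapOfInjective _ (Submodule.subtype_injective _) _).len_eq,
      ← LinearMap.range_comp, ← LinearMap.comp_assoc] at h1
    exact ⟨g ∘ₗ h, by rw [← hg, ← h1]; change _ = len A (LinearMap.range (g ∘ₗ h)) + 1 + m; omega⟩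

variable (D) in
/-- The combinatorial data of the algebra: the Kupisch series. -/
def kupisch : KupischData D.V where
  succ := D.succ
  len v := len A (D.P v)
  two_le := D.two_le
  le_succ v := by
    obtain ⟨g, hg⟩ := exists_len_range_add_eq v 1 (by have := D.two_le v; omega)
    have hs : len A (D.P ((D.succ ^ 1) v)) = len A (D.P (D.succ v)) := by rw [pow_one]
    have := len_eq_ker_add g.surjective_rangeRestrict
    omega

theorem equiv_U {M : Type} [AddCommGroup M] [Module A M] {v : D.V} {f : D.P v →ₗ[A] M}
    (hf : Surjective f) : D.kupisch.Valid (v, len A M) ∧ Nonempty (M ≃ₗ[A] D.U (v, len A M)) := by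
  have hle : len A M ≤ len A (D.P v) := by
    have := len_eq_ker_add hf
    omega
  exact ⟨hle, equiv_of_surjective hf (D.proj_surjective (v, len A M))
    (len_U (L := (v, len A M)) hle).symm⟩

theorem nontrivial_U {L : D.V × ℕ} (h : D.kupisch.Valid L) : Nontrivial (D.U L) ↔ L.2 ≠ 0 := by
  rw [← len_pos_iff (A := A), len_U h, Nat.pos_iff_ne_zero]

theorem eq_of_equiv_U {L L' : D.V × ℕ} (hL : D.kupisch.Valid L) (hL' : D.kupisch.Valid L')
    (h0 : L.2 ≠ 0) (e : D.U L' ≃ₗ[A] D.U L) : L' = L := by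
  have := (nontrivial_U hL).2 h0
  have hlen := e.len_eq
  rw [len_U hL, len_U hL'] at hlen
  exact Prod.ext (vertex_unique (f := e.toLinearMap ∘ₗ D.proj L')
    (e.surjective.comp (D.proj_surjective L')) (D.proj_surjective L)) hlen

theorem projective_U_iff {L : D.V × ℕ} (h : D.kupisch.Valid L) :
    Module.Projective A (D.U L) ↔ D.kupisch.Proj L := by
  constructor
  · intro hP
    by_cases h0 : L.2 = 0
    · exact Or.inl h0
    have := (nontrivial_U h).2 h0
    obtain ⟨s, hs⟩ := Module.projective_lifting_property (D.proj L) LinearMap.id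
      (D.proj_surjective L)
    have hb := (D.uniserial L.1).bijective_of_retract hs
    have hlen := (LinearEquiv.ofBijective _ hb).len_eq
    rw [len_U h] at hlen
    exact Or.inr hlen.symm
  · rintro (h0 | h1)
    · have : Subsingleton (D.U L) := by
        rwa [← not_nontrivial_iff_subsingleton, nontrivial_U h, not_not]
      exact projective_of_subsingleton
    · obtain ⟨e⟩ := equiv_of_surjective (f := (LinearMap.id : D.P L.1 →ₗ[A] D.P L.1))
        surjective_id (D.proj_surjective L) (by rw [len_U h, h1]; rfl)
      exact Module.Projective.of_equiv e

theorem isSyzygyOf_U {L : D.V × ℕ} (h : D.kupisch.Valid L) :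
    IsSyzygyOf A (D.U (D.kupisch.omega L)) (D.U L) := by
  by_cases h0 : L.2 = 0
  · have : Subsingleton (D.U L) := by
      rwa [← not_nontrivial_iff_subsingleton, nontrivial_U h, not_not]
    rw [KupischData.omega, if_pos h0]
    refine ⟨D.U L, LinearMap.id, projective_of_subsingleton, inferInstance, surjective_id, ?_, ⟨?_⟩⟩
    · intro K hK
      rwa [LinearMap.ker_id, bot_sup_eq] at hK
    · exact LinearEquiv.ofSubsingleton _ _
  have := (nontrivial_U h).2 h0
  refine ⟨D.P L.1, D.proj L, inferInstance, inferInstance, D.proj_surjective L,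
    isSmallSubmodule_ker (D.proj_surjective L), ?_⟩
  have hv := h.omega
  rw [KupischData.omega, if_neg h0] at hv ⊢
  obtain ⟨g, hg⟩ := exists_len_range_add_eq L.1 L.2 h
  have hker := len_ker_proj h
  have hrange : LinearMap.range g = LinearMap.ker (D.proj L) :=
    (D.uniserial L.1).eq_of_len_eq (by omega)
  have hlen := len_U hv
  change len A _ = len A (D.P L.1) - L.2 at hlen
  obtain ⟨e⟩ := equiv_of_surjective (D.proj_surjective
    ((D.succ ^ L.2) L.1, D.kupisch.len L.1 - L.2))
    g.surjective_rangeRestrict (hlen.trans (by omega))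
  exact ⟨e ≪≫ₗ LinearEquiv.ofEq _ _ hrange⟩

theorem exists_equiv_pi_U (D : NakayamaModel A) (M : ModuleCat.{0} A) (hM : Module.Finite A M) :
    ∃ (κ : Type) (_ : Fintype κ) (L : κ → D.V × ℕ), (∀ k, D.kupisch.Valid (L k)) ∧
      Nonempty (M ≃ₗ[A] Π k, D.U (L k)) := by
  obtain ⟨κ, _, X, hX, ⟨e⟩⟩ := D.exists_decomposition M hM
  have h : ∀ k, ∃ L, D.kupisch.Valid L ∧ Nonempty (X k ≃ₗ[A] D.U L) := fun k => by
    obtain ⟨_, _, hu⟩ := hX k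
    obtain ⟨v, f, hf⟩ := D.exists_cover hu
    exact ⟨_, equiv_U hf⟩
  choose L hL e' using h
  exact ⟨κ, inferInstance, L, hL, ⟨e ≪≫ₗ LinearEquiv.piCongrRight fun k => (e' k).some⟩⟩

theorem isNthSyzygyOf_pi_iff {κ : Type} [Fintype κ] {L : κ → D.V × ℕ}
    (hL : ∀ k, D.kupisch.Valid (L k)) {M : ModuleCat.{0} A} (e : M ≃ₗ[A] Π k, D.U (L k)) (n : ℕ)
    (N : ModuleCat.{0} A) :
    IsNthSyzygyOf A n N M ↔ Nonempty (N ≃ₗ[A] Π k, D.U (D.kupisch.omega^[n] (L k))) :=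
  isNthSyzygyOf_iff (X := fun n => ModuleCat.of A (Π k, D.U (D.kupisch.omega^[n] (L k))))
    (fun n => IsSyzygyOf.pi fun k => by
      rw [iterate_succ_apply']
      exact isSyzygyOf_U ((hL k).iterate_omega n)) e n N

theorem isNthSyzygyOf_U_iff {L : D.V × ℕ} (hL : D.kupisch.Valid L) {M : ModuleCat.{0} A}
    (e : M ≃ₗ[A] D.U L) (n : ℕ) (N : ModuleCat.{0} A) :
    IsNthSyzygyOf A n N M ↔ Nonempty (N ≃ₗ[A] D.U (D.kupisch.omega^[n] L)) :=
  isNthSyzygyOf_iff (X := fun n => D.U (D.kupisch.omega^[n] L))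
    (fun n => by
      rw [iterate_succ_apply']
      exact isSyzygyOf_U (hL.iterate_omega n)) e n N

theorem projective_pi_U_iff {κ : Type} [Fintype κ] {L : κ → D.V × ℕ}
    (hL : ∀ k, D.kupisch.Valid (L k)) :
    Module.Projective A (Π k, D.U (L k)) ↔ ∀ k, D.kupisch.Proj (L k) := by
  refine ⟨fun h k => (projective_U_iff (hL k)).1 ?_,
    fun h => projective_pi fun k => (projective_U_iff (hL k)).2 (h k)⟩
  exact Module.Projective.of_split (LinearMap.single A (fun k => ↥(D.U (L k))) k)
    (LinearMap.proj k) (by ext; simp)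

theorem projDim_le_iff {κ : Type} [Fintype κ] {L : κ → D.V × ℕ}
    (hL : ∀ k, D.kupisch.Valid (L k)) {M : ModuleCat.{0} A} (e : M ≃ₗ[A] Π k, D.U (L k)) (d : ℕ) :
    projDim A M ≤ d ↔ ∀ k, D.kupisch.Proj (D.kupisch.omega^[d] (L k)) := by
  have hn : ∀ n, (∃ N : ModuleCat.{0} A, IsNthSyzygyOf A n N M ∧ Module.Projective A N) ↔
      ∀ k, D.kupisch.Proj (D.kupisch.omega^[n] (L k)) := fun n => by
    rw [← projective_pi_U_iff fun k => (hL k).iterate_omega n]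
    constructor
    · rintro ⟨N, hN, _⟩
      obtain ⟨e'⟩ := (isNthSyzygyOf_pi_iff hL e n N).1 hN
      exact Module.Projective.of_equiv e'
    · exact fun h => ⟨ModuleCat.of A _, (isNthSyzygyOf_pi_iff hL e n _).2 ⟨LinearEquiv.refl A _⟩, h⟩
  rw [projDim, sInf_image_natCast_le_iff]
  simp only [Set.mem_ofPred_eq, hn]
  exact ⟨fun ⟨n, hnd, h⟩ k => (h k).iterate_omega_of_le hnd, fun h => ⟨d, le_rfl, h⟩⟩

theorem finDim_le_iff (D : NakayamaModel A) (d : ℕ) : finDim A ≤ d ↔ D.kupisch.FinBound d := by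
  rw [finDim, sSup_le_iff]
  constructor
  · intro h L hL ⟨n, hn⟩
    let e : D.U L ≃ₗ[A] Π _ : Unit, D.U L := (LinearEquiv.funUnique Unit A (D.U L)).symm
    have hle := projDim_le_iff (κ := Unit) (fun _ => hL) e
    refine (hle d).1 (h _ ⟨?_, D.U L, inferInstance, rfl⟩) ()
    exact ne_top_of_le_ne_top (ENat.natCast_ne_top n) ((hle n).2 fun _ => hn)
  · rintro h _ ⟨htop, M, hM, rfl⟩
    obtain ⟨κ, _, L, hL, ⟨e⟩⟩ := D.exists_equiv_pi_U M hM
    obtain ⟨n, hn⟩ := ENat.ne_top_iff_exists.1 htop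
    exact (projDim_le_iff hL e d).2 fun k =>
      h _ (hL k) ⟨n, (projDim_le_iff hL e n).1 hn.ge k⟩

theorem isRetract_U_of_proj {L : D.V × ℕ} (hL : D.kupisch.Valid L) (h : D.kupisch.Proj L) :
    IsRetract A (D.U L) A := by
  rcases h with h0 | h1
  · have : Subsingleton (D.U L) := by
      rwa [← not_nontrivial_iff_subsingleton, nontrivial_U hL, not_not]
    exact ⟨0, 0, LinearMap.ext fun _ => Subsingleton.elim _ _⟩
  · obtain ⟨e⟩ := equiv_of_surjective (f := (LinearMap.id : D.P L.1 →ₗ[A] D.P L.1))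
      surjective_id (D.proj_surjective L) (by rw [len_U hL, h1]; rfl)
    obtain ⟨i, hi⟩ := D.vertex_surjective L.1
    rw [← hi] at e
    exact (IsRetract.of_equiv e.symm).trans
      ((IsRetract.pi (fun i => D.P (D.vertex i)) i).trans (.of_equiv D.equiv.symm))

theorem delMod_le_iff {v : D.V} {S : ModuleCat.{0} A} (e : S ≃ₗ[A] D.U (v, 1)) (d : ℕ) :
    delMod A S ≤ d ↔ ∃ n ≤ d, D.kupisch.Proj (D.kupisch.omega^[n] (v, 1)) ∨
      ∃ L, D.kupisch.Valid L ∧ D.kupisch.omega^[n + 1] L = D.kupisch.omega^[n] (v, 1) := by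
  have hv : D.kupisch.Valid (v, 1) := one_le_two.trans (D.two_le v)
  rw [delMod, sInf_image_natCast_le_iff]
  refine exists_congr fun n => and_congr_right fun _ => ?_
  have hT := hv.iterate_omega n
  have hnth := isNthSyzygyOf_U_iff hv e n
  set T := D.kupisch.omega^[n] (v, 1)
  constructor
  · rintro ⟨M', N, N', hM', hN, hN', hsum⟩
    obtain ⟨eN⟩ := (hnth N).1 hN
    obtain ⟨κ, _, L, hL, ⟨eM'⟩⟩ := D.exists_equiv_pi_U M' hM'
    obtain ⟨eN'⟩ := (isNthSyzygyOf_pi_iff hL eM' (n + 1) N').1 hN'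
    by_cases h0 : T.2 = 0
    · exact Or.inl (Or.inl h0)
    have := (nontrivial_U hT).2 h0
    have hr := (IsRetract.of_equiv eN.symm).trans (isDirectSummandOf_iff.1 hsum)
    rcases (uniserial_U T).retract_of_retract_prod hr with hr | hr
    · exact Or.inl ((projective_U_iff hT).1 hr.projective)
    · obtain ⟨k, a, b, hab⟩ := (uniserial_U T).retract_of_retract_pi
        (X := fun k => D.U (D.kupisch.omega^[n + 1] (L k))) (hr.trans (.of_equiv eN'))
      exact Or.inr ⟨L k, hL k, eq_of_equiv_U hT ((hL k).iterate_omega (n + 1)) h0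
        (LinearEquiv.ofBijective b ((uniserial_U _).bijective_of_retract hab))⟩
  · have key : ∀ L, D.kupisch.Valid L →
        IsRetract A (D.U T) (A × D.U (D.kupisch.omega^[n + 1] L)) →
          ∃ M' N N' : ModuleCat.{0} A, Module.Finite A M' ∧ IsNthSyzygyOf A n N S ∧
            IsNthSyzygyOf A (n + 1) N' M' ∧ IsDirectSummandOf A N (ModuleCat.of A (A × N')) :=
      fun L hL hr =>
      ⟨D.U L, D.U T, D.U (D.kupisch.omega^[n + 1] L), inferInstance,
        (hnth _).2 ⟨LinearEquiv.refl A _⟩,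
        (isNthSyzygyOf_U_iff hL (LinearEquiv.refl A _) (n + 1) _).2 ⟨LinearEquiv.refl A _⟩,
        isDirectSummandOf_iff.2 hr⟩
    rintro (hp | ⟨L, hL, hLT⟩)
    · exact key T hT ((isRetract_U_of_proj hT hp).trans (.inl _ _))
    · exact key L hL (hLT ▸ .inr _ _)

theorem delAlg_le_iff (D : NakayamaModel A) (d : ℕ) : delAlg A ≤ d ↔ D.kupisch.DelBound d := by
  rw [delAlg, sSup_le_iff]
  constructor
  · intro h v
    have hv : 1 ≤ len A (D.P v) := one_le_two.trans (D.two_le v)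
    exact (delMod_le_iff (LinearEquiv.refl A (D.U (v, 1))) d).1
      (h _ ⟨D.U (v, 1), len_eq_one_iff.1 (len_U (L := (v, 1)) hv), rfl⟩)
  · rintro h _ ⟨S, hS, rfl⟩
    have := IsSimpleModule.nontrivial A S
    have hu : Uniserial A S := fun K K' =>
      (eq_bot_or_eq_top K).elim (fun h => .inl (h.le.trans bot_le))
        fun h => .inr (le_top.trans h.ge)
    obtain ⟨v, f, hf⟩ := D.exists_cover hu
    obtain ⟨-, ⟨e⟩⟩ := equiv_U hf
    rw [len_eq_one_iff.2 hS] at e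
    exact (delMod_le_iff e d).2 (h v)

end NakayamaModel

end Model

/-- For a cyclic Nakayama algebra `Λ` with `φdim Λ = 2`:
`findim Λ = 2` iff `del Λ = 2`. -/
theorem findim_two_iff_del_two_of_phiDim_two
    (A : Type) [Ring A] (hA : IsCyclicNakayama A) (hphi : phiDim A = 2) :
    finDim A = 2 ↔ delAlg A = 2 := by
  obtain ⟨⟨⟨_, hU⟩, -⟩, -, hS⟩ := hA
  obtain ⟨D⟩ := nonempty_nakayamaModel hU hS
  have h1 : finDim A ≤ 1 ↔ delAlg A ≤ 1 := by
    have hf := D.finDim_le_iff 1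
    have hd := D.delAlg_le_iff 1
    rw [Nat.cast_one] at hf hd
    rw [hf, hd, D.kupisch.finBound_one_iff_delBound_one]
  have h2 : finDim A ≤ 2 ↔ delAlg A ≤ 2 := by
    have hf := D.finDim_le_iff 2
    have hd := D.delAlg_le_iff 2
    rw [Nat.cast_two] at hf hd
    rw [hf, hd, D.kupisch.finBound_two_iff_delBound_two]
  have key : ∀ x : ℕ∞, x = 2 ↔ x ≤ 2 ∧ ¬ x ≤ 1 := fun x => by
    rw [not_le, ← ENat.add_one_le_iff (by simp), one_add_one_eq_two, le_antisymm_iff]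
  rw [key, key, h1, h2]

end
end

section
/- Let Λ be a cyclic Nakayama algebra with findim Λ = 1, and let S be a simple Λ-module with pdim S = 1. Then S is not the socle of any indecomposable projective Λ-module. -/
open Function DirectSum
open scoped Classical

noncomputable section

open CategoryTheory in
/-- The kernel of a surjection from a projective module is projective if and only if the target
has projective dimension at most one. -/
lemma projective_ker_iff_hasProjectiveDimensionLT_two {A : Type} [Ring A] {P M : Type}
    [AddCommGroup P] [Module A P] [AddCommGroup M] [Module A M] [Module.Projective A P]
    (f : P →ₗ[A] M) (hf : Surjective f) :
    Module.Projective A (LinearMap.ker f) ↔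
      HasProjectiveDimensionLT (ModuleCat.of A M) 2 := by
  have hP : Projective (ModuleCat.of A P) :=
    (IsProjective.iff_projective P).mp inferInstance
  rw [IsProjective.iff_projective, projective_iff_hasProjectiveDimensionLT_one]
  exact ((LinearMap.shortExact_shortComplexKer hf).hasProjectiveDimensionLT_X₃_iff 0 hP).symm

/-- If a module has a projective syzygy of order at most one, then the kernel of any surjection
onto it from a projective module is projective. -/
lemma projective_ker_of_isNthSyzygyOf {A : Type} [Ring A] {P : Type} [AddCommGroup P]
    [Module A P] [Module.Projective A P] {M N : ModuleCat.{0} A} (f : P →ₗ[A] M)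
    (hf : Surjective f) {n : ℕ} (hn : n ≤ 1) (hN : IsNthSyzygyOf A n N M)
    (hproj : Module.Projective A N) : Module.Projective A (LinearMap.ker f) := by
  rw [projective_ker_iff_hasProjectiveDimensionLT_two f hf]
  interval_cases n
  · obtain ⟨e⟩ := hN
    rw [← projective_ker_iff_hasProjectiveDimensionLT_two e.toLinearMap e.surjective,
      LinearEquiv.ker]
    infer_instance
  · obtain ⟨K, ⟨e⟩, P', g, hP', -, hg, -, ⟨e'⟩⟩ := hN
    rw [← projective_ker_iff_hasProjectiveDimensionLT_two (e.toLinearMap ∘ₗ g)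
      (e.surjective.comp hg), LinearEquiv.ker_comp]
    exact Module.Projective.of_equiv e'

/-- A module of finite projective dimension `n` has a projective `n`-th syzygy. -/
lemma exists_projective_isNthSyzygyOf {A : Type} [Ring A] {M : ModuleCat.{0} A} {n : ℕ}
    (h : projDim A M = n) : ∃ N, IsNthSyzygyOf A n N M ∧ Module.Projective A N := by
  have hne : ((fun n : ℕ => (n : ℕ∞)) ''
      {n : ℕ | ∃ N, IsNthSyzygyOf A n N M ∧ Module.Projective A N}).Nonempty := by
    rw [Set.nonempty_iff_ne_empty]
    intro h0
    rw [projDim, h0, sInf_empty] at h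
    exact ENat.top_ne_natCast n h
  obtain ⟨m, hm, hmn⟩ := csInf_mem hne
  have : m = n := Nat.cast_injective (R := ℕ∞) (hmn.trans h)
  exact this ▸ hm

/-- A projective `n`-th syzygy bounds the projective dimension by `n`. -/
lemma projDim_le_of_isNthSyzygyOf {A : Type} [Ring A] {M N : ModuleCat.{0} A} {n : ℕ}
    (hN : IsNthSyzygyOf A n N M) (hproj : Module.Projective A N) : projDim A M ≤ n :=
  sInf_le ⟨n, ⟨N, hN, hproj⟩, rfl⟩

/-- A finite projective dimension of a finitely generated module is at most the finitistic
dimension. -/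
lemma projDim_le_finDim {A : Type} [Ring A] {M : ModuleCat.{0} A} (hM : Module.Finite A M)
    (h : projDim A M ≠ ⊤) : projDim A M ≤ finDim A :=
  le_sSup ⟨h, M, hM, rfl⟩

/-- A proper submodule of a uniserial module is small. -/
lemma IsUniserialModule.isSmallSubmodule {A : Type} [Ring A] {M : ModuleCat.{0} A}
    (hM : IsUniserialModule A M) {N : Submodule A M} (hN : N ≠ ⊤) : IsSmallSubmodule A N := by
  intro K hK
  rcases hM N K with h | h
  · rwa [sup_eq_right.mpr h] at hK
  · exact absurd (by rwa [sup_eq_left.mpr h] at hK) hN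

/-- Let `Λ` be a cyclic Nakayama algebra with `findim Λ = 1` and let
`S` be a simple module with `pdim S = 1`.  Then `S` is not the socle of any
indecomposable projective module. -/
theorem pdim_one_simple_not_socle_of_indec_projective
    (A : Type) [Ring A] (hA : IsCyclicNakayama A) (hfd : finDim A = 1)
    (S : ModuleCat.{0} A) (hS : IsSimpleModule A ↥S) (hpd : projDim A S = 1) :
    ¬ IsSocleOfIndecProjective A S := by
  rintro ⟨-, Q, hQ, hQfin, hQind, ⟨e⟩⟩
  have hSproj : ¬ Module.Projective A S := hA.2.2 S hS
  have hne : socleOf A Q ≠ ⊤ := fun h =>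
    hSproj (Module.Projective.of_equiv (e.trans (LinearEquiv.ofTop _ h)).symm)
  have hsmall := (hA.1.1.2 Q hQfin hQind).isSmallSubmodule hne
  have hsurj := (socleOf A Q).mkQ_surjective
  let M : ModuleCat.{0} A := ModuleCat.of A (Q ⧸ socleOf A Q)
  let eker : S ≃ₗ[A] LinearMap.ker (socleOf A Q).mkQ :=
    e.trans (LinearEquiv.ofEq _ _ (Submodule.ker_mkQ _).symm)
  obtain ⟨N, ⟨K, ⟨eK⟩, hNK⟩, hN⟩ := exists_projective_isNthSyzygyOf (n := 1) hpd
  have hKM : IsSyzygyOf A K M :=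
    ⟨Q, (socleOf A Q).mkQ, hQ, hQfin, hsurj, by rwa [Submodule.ker_mkQ], ⟨eK.trans eker⟩⟩
  have hNM : IsNthSyzygyOf A 2 N M := ⟨K, ⟨M, ⟨LinearEquiv.refl A M⟩, hKM⟩, hNK⟩
  have htop : projDim A M ≠ ⊤ :=
    ((projDim_le_of_isNthSyzygyOf hNM hN).trans_lt (ENat.natCast_lt_top 2)).ne
  have hMfin : Module.Finite A M := inferInstanceAs (Module.Finite A (Q ⧸ socleOf A Q))
  obtain ⟨n, hn⟩ := ENat.ne_top_iff_exists.mp htop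
  have hn1 : n ≤ 1 := by
    have h := projDim_le_finDim hMfin htop
    rw [hfd, ← hn] at h
    exact_mod_cast h
  obtain ⟨L, hL, hLproj⟩ := exists_projective_isNthSyzygyOf hn.symm
  have := projective_ker_of_isNthSyzygyOf (M := M) (socleOf A Q).mkQ hsurj hn1 hL hLproj
  exact hSproj (Module.Projective.of_equiv eker.symm)

end
end
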